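/- There exist constants C₁ > 0 and C > 0 such that for every statistics parameter α ∈ [0,1] and every integer N ≥ 1, the Neumann ground-state energy of N ideal anyons on the unit square satisfies E^N_N(α) ≥ C₁ α N² (1 − C/N). -/

import Mathlib

noncomputable section

open MeasureTheory Real Set
open scoped BigOperators Topology

/-- The plane `ℝ²`, with points written as pairs. -/
abbrev Plane : Type := ℝ × ℝ

/-- Configuration space of `N` particles in the plane. -/
abbrev Config (N : ℕ) : Type := Fin N → Plane

/-- `x^{-⊥} := (-y, x)/(x² + y²)` for `x = (x, y) ∈ ℝ²`. -/
def perpInv (v : Plane) : Plane :=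
  (-v.2 / (v.1 ^ 2 + v.2 ^ 2), v.1 / (v.1 ^ 2 + v.2 ^ 2))

/-- The Aharonov–Bohm potential `A_j(x) = ∑_{k ≠ j} (x_j - x_k)^{-⊥}`. -/
def abPot (N : ℕ) (j : Fin N) (x : Config N) : Plane :=
  ∑ k ∈ Finset.univ.erase j, perpInv (x j - x k)

/-- Partial derivative of `Ψ` at `x` in direction `v` of the `j`-th particle. -/
def pder (N : ℕ) (j : Fin N) (v : Plane) (Ψ : Config N → ℂ) (x : Config N) : ℂ :=
  fderiv ℝ Ψ x (Pi.single j v)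

/-- The two components of `D_j Ψ = -i ∇_{x_j} Ψ + α A_j Ψ` at `x`. -/
def DOp (N : ℕ) (α : ℝ) (j : Fin N) (Ψ : Config N → ℂ) (x : Config N) : ℂ × ℂ :=
  (-Complex.I * pder N j (1, 0) Ψ x + Complex.ofReal (α * (abPot N j x).1) * Ψ x,
   -Complex.I * pder N j (0, 1) Ψ x + Complex.ofReal (α * (abPot N j x).2) * Ψ x)

/-- `|D_j Ψ(x)|²`, the squared Euclidean norm of the vector `D_j Ψ(x) ∈ ℂ²`. -/
def DSq (N : ℕ) (α : ℝ) (j : Fin N) (Ψ : Config N → ℂ) (x : Config N) : ℝ :=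
  ‖(DOp N α j Ψ x).1‖ ^ 2 + ‖(DOp N α j Ψ x).2‖ ^ 2

/-- The diagonal set `{x : x_j = x_k for some j ≠ k}`. -/
def diagSet (N : ℕ) : Set (Config N) := {x | ∃ j k : Fin N, j ≠ k ∧ x j = x k}

/-- Admissible wave functions: smooth, symmetric, vanishing on a neighbourhood of
the diagonal set. -/
structure Admissible (N : ℕ) (Ψ : Config N → ℂ) : Prop where
  smooth : ContDiff ℝ (⊤ : ℕ∞) Ψ
  symm : ∀ (σ : Equiv.Perm (Fin N)) (x : Config N), Ψ (x ∘ σ) = Ψ x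
  vanishes : ∃ U : Set (Config N), IsOpen U ∧ diagSet N ⊆ U ∧ ∀ x ∈ U, Ψ x = 0

/-- `Ω^N` as a subset of configuration space. -/
def cube (N : ℕ) (Ω : Set Plane) : Set (Config N) := Set.univ.pi fun _ => Ω

/-- Total kinetic energy `∑_j ∫_{Ω^N} |D_j Ψ|²`. -/
def kinE (N : ℕ) (α : ℝ) (Ω : Set Plane) (Ψ : Config N → ℂ) : ℝ :=
  ∑ j, ∫ x in cube N Ω, DSq N α j Ψ x

/-- `∫_{Ω^N} |Ψ|²`. -/
def normSq (N : ℕ) (Ω : Set Plane) (Ψ : Config N → ℂ) : ℝ :=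
  ∫ x in cube N Ω, ‖Ψ x‖ ^ 2

/-- Neumann ground-state energy of `N` anyons with statistics parameter `α` on `Ω`,
with the convention that it is `0` for `N = 0`. -/
def neumannE (N : ℕ) (α : ℝ) (Ω : Set Plane) : ℝ :=
  if N = 0 then 0 else
    sInf {E | ∃ Ψ : Config N → ℂ, Admissible N Ψ ∧ normSq N Ω Ψ = 1 ∧ E = kinE N α Ω Ψ}

/-- Dirichlet ground-state energy of `N` anyons with statistics parameter `α` on `Ω`. -/
def dirichletE (N : ℕ) (α : ℝ) (Ω : Set Plane) : ℝ :=
  sInf {E | ∃ Ψ : Config N → ℂ, Admissible N Ψ ∧ IsCompact (tsupport Ψ) ∧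
    tsupport Ψ ⊆ cube N Ω ∧ normSq N Ω Ψ = 1 ∧ E = kinE N α Ω Ψ}

/-- The open unit square `Q₀ = (0,1)²`. -/
def Q0 : Set Plane := Set.Ioo (0 : ℝ) 1 ×ˢ Set.Ioo (0 : ℝ) 1

/-- `E^N_N(α)`, the Neumann energy on the unit square. -/
def EN (N : ℕ) (α : ℝ) : ℝ := neumannE N α Q0

/-- `E^D_N(α)`, the Dirichlet energy on the unit square. -/
def ED (N : ℕ) (α : ℝ) : ℝ := dirichletE N α Q0

/-- One-particle density `ρ_Ψ` of a wave function of `n+1` particles. -/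
def density (n : ℕ) (Ψ : Config (n + 1) → ℂ) (y : Plane) : ℝ :=
  (n + 1) * ∫ z : Config n, ‖Ψ (Fin.cons y z)‖ ^ 2

lemma perpInv_continuousAt {v : Plane} (hv : v ≠ 0) : ContinuousAt perpInv v := by
  have h0 : v.1 ^ 2 + v.2 ^ 2 ≠ 0 := by
    intro h
    apply hv
    have h1 : v.1 = 0 := by nlinarith [sq_nonneg v.1, sq_nonneg v.2]
    have h2 : v.2 = 0 := by nlinarith [sq_nonneg v.1, sq_nonneg v.2]
    exact Prod.ext h1 h2
  unfold perpInv
  refine ContinuousAt.prodMk ?_ ?_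
  · exact ContinuousAt.div (by fun_prop) (by fun_prop) h0
  · exact ContinuousAt.div (by fun_prop) (by fun_prop) h0

lemma abPot_continuousAt {N : ℕ} (j : Fin N) {x : Config N} (hx : x ∉ diagSet N) :
    ContinuousAt (abPot N j) x := by
  unfold abPot
  refine tendsto_finsetSum _ (fun k hk => ?_)
  have hkj : k ≠ j := (Finset.mem_erase.1 hk).1
  have hne : x j - x k ≠ 0 := by
    intro h
    exact hx ⟨j, k, hkj.symm, sub_eq_zero.1 h⟩
  have h1 : ContinuousAt (fun y : Config N => y j - y k) x := by fun_prop
  exact ContinuousAt.comp (f := fun y : Config N => y j - y k) (g := perpInv)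
    (perpInv_continuousAt hne) h1

lemma Admissible.differentiable {N : ℕ} {Ψ : Config N → ℂ} (h : Admissible N Ψ) :
    Differentiable ℝ Ψ := h.smooth.differentiable (by simp)

lemma Admissible.continuous {N : ℕ} {Ψ : Config N → ℂ} (h : Admissible N Ψ) :
    Continuous Ψ := h.smooth.continuous

lemma Admissible.continuous_fderiv {N : ℕ} {Ψ : Config N → ℂ} (h : Admissible N Ψ) :
    Continuous (fderiv ℝ Ψ) := h.smooth.continuous_fderiv (by simp)

lemma pot_mul_continuous {N : ℕ} {Ψ : Config N → ℂ} (h : Admissible N Ψ) (α : ℝ) (j : Fin N)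
    (pr : Plane → ℝ) (hpr : Continuous pr) :
    Continuous (fun x => Complex.ofReal (α * pr (abPot N j x)) * Ψ x) := by
  rw [continuous_iff_continuousAt]
  intro x
  obtain ⟨U, hU, hd, hz⟩ := h.vanishes
  by_cases hx : x ∈ diagSet N
  · have : (fun x => Complex.ofReal (α * pr (abPot N j x)) * Ψ x) =ᶠ[𝓝 x] fun _ => 0 := by
      filter_upwards [hU.mem_nhds (hd hx)] with y hy
      rw [hz y hy, mul_zero]
    exact (continuousAt_const).congr this.symm
  · refine ContinuousAt.mul ?_ h.continuous.continuousAt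
    refine Complex.continuous_ofReal.continuousAt.comp ?_
    refine continuousAt_const.mul ?_
    exact hpr.continuousAt.comp (abPot_continuousAt j hx)

lemma DOp_fst_continuous {N : ℕ} {Ψ : Config N → ℂ} (h : Admissible N Ψ) (α : ℝ) (j : Fin N) :
    Continuous (fun x => (DOp N α j Ψ x).1) := by
  unfold DOp pder
  refine Continuous.add ?_ (pot_mul_continuous h α j (fun p => p.1) continuous_fst)
  exact continuous_const.mul (h.continuous_fderiv.clm_apply continuous_const)

lemma DOp_snd_continuous {N : ℕ} {Ψ : Config N → ℂ} (h : Admissible N Ψ) (α : ℝ) (j : Fin N) :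
    Continuous (fun x => (DOp N α j Ψ x).2) := by
  unfold DOp pder
  refine Continuous.add ?_ (pot_mul_continuous h α j (fun p => p.2) continuous_snd)
  exact continuous_const.mul (h.continuous_fderiv.clm_apply continuous_const)

lemma DSq_continuous {N : ℕ} {Ψ : Config N → ℂ} (h : Admissible N Ψ) (α : ℝ) (j : Fin N) :
    Continuous (DSq N α j Ψ) := by
  unfold DSq
  exact ((DOp_fst_continuous h α j).norm.pow 2).add ((DOp_snd_continuous h α j).norm.pow 2)

lemma DSq_nonneg {N : ℕ} (Ψ : Config N → ℂ) (α : ℝ) (j : Fin N) (x : Config N) :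
    0 ≤ DSq N α j Ψ x := by
  unfold DSq; positivity

/-- Directional covariant derivative for moving particles `j`, `k` in directions `v`, `w`. -/
def D2 (N : ℕ) (α : ℝ) (j k : Fin N) (Ψ : Config N → ℂ) (x : Config N) (v v' : Plane) : ℂ :=
  v.1 * (DOp N α j Ψ x).1 + v.2 * (DOp N α j Ψ x).2
    + v'.1 * (DOp N α k Ψ x).1 + v'.2 * (DOp N α k Ψ x).2

/-- The real one-form of the gauge potential evaluated on the direction. -/
def potForm (N : ℕ) (j k : Fin N) (x : Config N) (v v' : Plane) : ℝ :=
  (abPot N j x).1 * v.1 + (abPot N j x).2 * v.2 + (abPot N k x).1 * v'.1 + (abPot N k x).2 * v'.2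

lemma single_decomp {N : ℕ} (j : Fin N) (v : Plane) :
    (Pi.single j v : Config N) = v.1 • (Pi.single j ((1, 0) : Plane) : Config N)
      + v.2 • (Pi.single j ((0, 1) : Plane) : Config N) := by
  rw [← Pi.single_smul, ← Pi.single_smul, ← Pi.single_add]
  congr 1
  ext <;> simp

lemma fderiv_dir {N : ℕ} (Ψ : Config N → ℂ) (α : ℝ) (j k : Fin N) (x : Config N) (v v' : Plane) :
    fderiv ℝ Ψ x (Pi.single j v + Pi.single k v')
      = Complex.I * D2 N α j k Ψ x v v' - Complex.I * ((α * potForm N j k x v v' : ℝ) : ℂ) * Ψ x := by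
  rw [single_decomp j v, single_decomp k v']
  simp only [map_add, map_smul, D2, potForm, DOp, pder, Complex.real_smul]
  push_cast
  linear_combination -1 * (-(v.1 * (fderiv ℝ Ψ x) (Pi.single j (1, 0)))
    - (v.2 * (fderiv ℝ Ψ x) (Pi.single j (0, 1)))
    - (v'.1 * (fderiv ℝ Ψ x) (Pi.single k (1, 0)))
    - (v'.2 * (fderiv ℝ Ψ x) (Pi.single k (0, 1)))) * Complex.I_sq

lemma D2_norm_sq_le {N : ℕ} (Ψ : Config N → ℂ) (α : ℝ) (j k : Fin N) (x : Config N) (v v' : Plane) :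
    ‖D2 N α j k Ψ x v v'‖ ^ 2 ≤ (v.1 ^ 2 + v.2 ^ 2 + v'.1 ^ 2 + v'.2 ^ 2)
      * (DSq N α j Ψ x + DSq N α k Ψ x) := by
  unfold D2 DSq
  set a := (DOp N α j Ψ x).1
  set b := (DOp N α j Ψ x).2
  set c := (DOp N α k Ψ x).1
  set d := (DOp N α k Ψ x).2
  have h1 : ‖(v.1 : ℂ) * a + v.2 * b + v'.1 * c + v'.2 * d‖
      ≤ |v.1| * ‖a‖ + |v.2| * ‖b‖ + |v'.1| * ‖c‖ + |v'.2| * ‖d‖ := by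
    refine (norm_add_le _ _).trans (add_le_add ?_ (by simp))
    refine (norm_add_le _ _).trans (add_le_add ?_ (by simp))
    refine (norm_add_le _ _).trans (add_le_add (by simp) (by simp))
  have h2 : ‖(v.1 : ℂ) * a + v.2 * b + v'.1 * c + v'.2 * d‖ ^ 2
      ≤ (|v.1| * ‖a‖ + |v.2| * ‖b‖ + |v'.1| * ‖c‖ + |v'.2| * ‖d‖) ^ 2 := by
    gcongr
  refine h2.trans ?_
  rw [← sq_abs v.1, ← sq_abs v.2, ← sq_abs v'.1, ← sq_abs v'.2]
  nlinarith [sq_nonneg (|v.1| * ‖b‖ - |v.2| * ‖a‖), sq_nonneg (|v.1| * ‖c‖ - |v'.1| * ‖a‖),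
    sq_nonneg (|v.1| * ‖d‖ - |v'.2| * ‖a‖), sq_nonneg (|v.2| * ‖c‖ - |v'.1| * ‖b‖),
    sq_nonneg (|v.2| * ‖d‖ - |v'.2| * ‖b‖), sq_nonneg (|v'.1| * ‖d‖ - |v'.2| * ‖c‖)]

lemma D2_norm_sq_le_left {N : ℕ} (Ψ : Config N → ℂ) (α : ℝ) (j k : Fin N) (x : Config N) (v : Plane) :
    ‖D2 N α j k Ψ x v 0‖ ^ 2 ≤ (v.1 ^ 2 + v.2 ^ 2) * DSq N α j Ψ x := by
  unfold D2 DSq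
  set a := (DOp N α j Ψ x).1
  set b := (DOp N α j Ψ x).2
  simp only [Prod.fst_zero, Prod.snd_zero, Complex.ofReal_zero, zero_mul, add_zero]
  have h1 : ‖(v.1 : ℂ) * a + v.2 * b‖ ≤ |v.1| * ‖a‖ + |v.2| * ‖b‖ :=
    (norm_add_le _ _).trans (add_le_add (by simp) (by simp))
  have h2 : ‖(v.1 : ℂ) * a + v.2 * b‖ ^ 2 ≤ (|v.1| * ‖a‖ + |v.2| * ‖b‖) ^ 2 := by
    gcongr
  refine h2.trans ?_
  rw [← sq_abs v.1, ← sq_abs v.2]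
  nlinarith [sq_nonneg (|v.1| * ‖b‖ - |v.2| * ‖a‖)]

/-- Derivative of `|Ψ|²` in a direction. -/
def gder {N : ℕ} (Ψ : Config N → ℂ) (x w : Config N) : ℝ := 2 * inner ℝ (Ψ x) (fderiv ℝ Ψ x w)

lemma gder_hasDerivAt {N : ℕ} {Ψ : Config N → ℂ} (h : Admissible N Ψ) {γ : ℝ → Config N}
    {w : Config N} {t : ℝ} (hγ : HasDerivAt γ w t) :
    HasDerivAt (fun t => ‖Ψ (γ t)‖ ^ 2) (gder Ψ (γ t) w) t := by
  have h1 : HasDerivAt (fun t => Ψ (γ t)) (fderiv ℝ Ψ (γ t) w) t :=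
    (h.differentiable (γ t)).hasFDerivAt.comp_hasDerivAt t hγ
  exact h1.norm_sq

lemma gder_abs_le {N : ℕ} (Ψ : Config N → ℂ) (α : ℝ) (j k : Fin N) (x : Config N) (v v' : Plane) :
    |gder Ψ x (Pi.single j v + Pi.single k v')| ≤ 2 * ‖Ψ x‖ * ‖D2 N α j k Ψ x v v'‖ := by
  unfold gder
  rw [fderiv_dir Ψ α j k x v v', inner_sub_right]
  have : inner ℝ (Ψ x) (Complex.I * ((α * potForm N j k x v v' : ℝ) : ℂ) * Ψ x) = 0 := by
    rw [Complex.inner]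
    simp [Complex.mul_re, Complex.mul_im]
    ring
  rw [this, sub_zero, abs_mul, abs_two, mul_assoc]
  have h2 := abs_real_inner_le_norm (Ψ x) (Complex.I * D2 N α j k Ψ x v v')
  rw [norm_mul, Complex.norm_I, one_mul] at h2
  linarith


lemma ftc_lintegral_le {F F' b : ℝ → ℝ} {p q : ℝ} (hpq : p ≤ q)
    (hF : ∀ t ∈ Set.Icc p q, HasDerivAt F (F' t) t) (hc : ContinuousOn F' (Set.Icc p q))
    (hb : ∀ t ∈ Set.Ioc p q, F' t ≤ b t) :
    ENNReal.ofReal (F q) ≤ ENNReal.ofReal (F p) + ∫⁻ t in Set.Ioc p q, ENNReal.ofReal (b t) := by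
  have hFI : IntervalIntegrable F' volume p q := by
    apply ContinuousOn.intervalIntegrable
    rwa [Set.uIcc_of_le hpq]
  have h1 : ∫ t in p..q, F' t = F q - F p := by
    apply intervalIntegral.integral_eq_sub_of_hasDerivAt
    · intro t ht
      rw [Set.uIcc_of_le hpq] at ht
      exact hF t ht
    · exact hFI
  rw [intervalIntegral.integral_of_le hpq] at h1
  have hFI' : IntegrableOn F' (Set.Ioc p q) := (intervalIntegrable_iff_integrableOn_Ioc_of_le hpq).1 hFI
  have h2 : ENNReal.ofReal (∫ t in Set.Ioc p q, F' t) ≤ ∫⁻ t in Set.Ioc p q, ENNReal.ofReal (b t) := by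
    calc ENNReal.ofReal (∫ t in Set.Ioc p q, F' t)
        ≤ ENNReal.ofReal (∫ t in Set.Ioc p q, max (F' t) 0) := by
          apply ENNReal.ofReal_le_ofReal
          exact integral_mono hFI' hFI'.pos_part (fun t => le_max_left _ _)
      _ = ∫⁻ t in Set.Ioc p q, ENNReal.ofReal (max (F' t) 0) :=
          ofReal_integral_eq_lintegral_ofReal hFI'.pos_part
            (Filter.Eventually.of_forall fun t => le_max_right _ _)
      _ ≤ ∫⁻ t in Set.Ioc p q, ENNReal.ofReal (b t) := by
          refine setLIntegral_mono_ae' measurableSet_Ioc (Filter.Eventually.of_forall fun t ht => ?_)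
          rw [ENNReal.ofReal_max, ENNReal.ofReal_zero]
          exact max_le (ENNReal.ofReal_le_ofReal (hb t ht)) (zero_le)
  have h3 : F q = F p + ∫ t in Set.Ioc p q, F' t := by linarith
  rw [h3]
  exact ENNReal.ofReal_add_le.trans (by gcongr)

lemma gder_continuous {N : ℕ} {Ψ : Config N → ℂ} (h : Admissible N Ψ) {γ w : ℝ → Config N}
    (hγ : Continuous γ) (hw : Continuous w) : Continuous (fun t => gder Ψ (γ t) (w t)) := by
  unfold gder
  exact continuous_const.mul ((h.continuous.comp hγ).inner
    ((h.continuous_fderiv.comp hγ).clm_apply hw))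

lemma poinc_point {N : ℕ} {Ψ : Config N → ℂ} (h : Admissible N Ψ) (α : ℝ) (j k : Fin N)
    (x : Config N) (v v' : Plane) :
    ENNReal.ofReal (‖Ψ (x + (Pi.single j v + Pi.single k v'))‖ ^ 2)
      ≤ ENNReal.ofReal (Real.exp 1) * (ENNReal.ofReal (‖Ψ x‖ ^ 2)
        + ∫⁻ t in Set.Ioc (0 : ℝ) 1, ENNReal.ofReal ((v.1 ^ 2 + v.2 ^ 2 + v'.1 ^ 2 + v'.2 ^ 2)
            * (DSq N α j Ψ (x + t • (Pi.single j v + Pi.single k v'))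
              + DSq N α k Ψ (x + t • (Pi.single j v + Pi.single k v'))))) := by
  set w : Config N := Pi.single j v + Pi.single k v' with hw
  have hγ : ∀ t : ℝ, HasDerivAt (fun t : ℝ => x + t • w) w t := by
    intro t
    simpa using ((hasDerivAt_id t).smul_const w).const_add x
  have hγc : Continuous (fun t : ℝ => x + t • w) := by fun_prop
  have key := ftc_lintegral_le (F := fun t => Real.exp (-t) * ‖Ψ (x + t • w)‖ ^ 2)
    (F' := fun t => -Real.exp (-t) * ‖Ψ (x + t • w)‖ ^ 2 + Real.exp (-t) * gder Ψ (x + t • w) w)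
    (b := fun t => (v.1 ^ 2 + v.2 ^ 2 + v'.1 ^ 2 + v'.2 ^ 2)
            * (DSq N α j Ψ (x + t • w) + DSq N α k Ψ (x + t • w))) zero_le_one ?_ ?_ ?_
  · simp only [neg_zero, Real.exp_zero, one_mul, zero_smul, add_zero, one_smul] at key
    have h2 : ‖Ψ (x + w)‖ ^ 2 = Real.exp 1 * (Real.exp (-1) * ‖Ψ (x + w)‖ ^ 2) := by
      rw [← mul_assoc, ← Real.exp_add]; simp
    rw [h2, ENNReal.ofReal_mul (Real.exp_pos _).le]
    gcongr
  · intro t _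
    have h1 := gder_hasDerivAt h (hγ t)
    have h2 : HasDerivAt (fun t : ℝ => Real.exp (-t)) (-Real.exp (-t)) t := by
      simpa using (hasDerivAt_neg t).exp
    exact h2.mul h1
  · apply Continuous.continuousOn
    have h1 := gder_continuous h hγc (continuous_const (y := w))
    have h2 := (h.continuous.comp hγc).norm.pow 2
    have h3 : Continuous (fun t : ℝ => Real.exp (-t)) := by fun_prop
    exact (h3.neg.mul h2).add (h3.mul h1)
  · intro t ht
    have h1 := gder_abs_le Ψ α j k (x + t • w) v v'
    rw [← hw] at h1
    have h2 := D2_norm_sq_le Ψ α j k (x + t • w) v v'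
    have h3 := (le_abs_self _).trans h1
    have h4 : gder Ψ (x + t • w) w - ‖Ψ (x + t • w)‖ ^ 2 ≤ ‖D2 N α j k Ψ (x + t • w) v v'‖ ^ 2 := by
      nlinarith [sq_nonneg (‖Ψ (x + t • w)‖ - ‖D2 N α j k Ψ (x + t • w) v v'‖)]
    have h5 : Real.exp (-t) ≤ 1 := Real.exp_le_one_iff.2 (by linarith [ht.1])
    have h6 : 0 ≤ ‖D2 N α j k Ψ (x + t • w) v v'‖ ^ 2 := by positivity
    nlinarith [Real.exp_pos (-t), mul_le_mul_of_nonneg_left h4 (Real.exp_pos (-t)).le,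
      mul_le_mul_of_nonneg_right h5 h6]

/-- The half open box with corner `a` and side `s`. -/
def box (a : Plane) (s : ℝ) : Set Plane := Set.Ico a.1 (a.1 + s) ×ˢ Set.Ico a.2 (a.2 + s)

lemma mem_box {a : Plane} {s : ℝ} {p : Plane} :
    p ∈ box a s ↔ (a.1 ≤ p.1 ∧ p.1 < a.1 + s) ∧ (a.2 ≤ p.2 ∧ p.2 < a.2 + s) := by
  unfold box; simp [Set.mem_prod]

lemma measurableSet_box (a : Plane) (s : ℝ) : MeasurableSet (box a s) :=
  measurableSet_Ico.prod measurableSet_Ico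

/-- Translation of a region. -/
lemma poinc_translate {N : ℕ} {Ψ : Config N → ℂ} (h : Admissible N Ψ) (α : ℝ) (j k : Fin N)
    (A A' P : Set (Config N)) (hA : MeasurableSet A) (hP : MeasurableSet P)
    (v v' : Plane) {s : ℝ} (hv : v.1 ^ 2 + v.2 ^ 2 + v'.1 ^ 2 + v'.2 ^ 2 ≤ 4 * s ^ 2)
    (hA' : ∀ x ∈ A', x - (Pi.single j v + Pi.single k v') ∈ A)
    (hsub : ∀ x ∈ A, ∀ t ∈ Set.Ioc (0 : ℝ) 1, x + t • (Pi.single j v + Pi.single k v') ∈ P) :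
    ∫⁻ x in A', ENNReal.ofReal (‖Ψ x‖ ^ 2) ≤ ENNReal.ofReal (Real.exp 1) *
      ((∫⁻ x in A, ENNReal.ofReal (‖Ψ x‖ ^ 2)) + ENNReal.ofReal (4 * s ^ 2) *
        ∫⁻ x in P, ENNReal.ofReal (DSq N α j Ψ x + DSq N α k Ψ x)) := by
  set w : Config N := Pi.single j v + Pi.single k v' with hw
  have hgm : Measurable (fun x => ENNReal.ofReal (‖Ψ x‖ ^ 2)) :=
    ENNReal.measurable_ofReal.comp (h.continuous.norm.pow 2).measurable
  have hDc : Continuous (fun x => DSq N α j Ψ x + DSq N α k Ψ x) :=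
    (DSq_continuous h α j).add (DSq_continuous h α k)
  have hDm : Measurable (fun x => ENNReal.ofReal (DSq N α j Ψ x + DSq N α k Ψ x)) :=
    ENNReal.measurable_ofReal.comp hDc.measurable
  have step1 : ∫⁻ x in A', ENNReal.ofReal (‖Ψ x‖ ^ 2)
      ≤ ∫⁻ x in A, ENNReal.ofReal (‖Ψ (x + w)‖ ^ 2) := by
    have mp : MeasurePreserving (fun x : Config N => x - w) volume volume :=
      measurePreserving_sub_right volume w
    have e1 := mp.setLIntegral_comp_preimage hA
      (f := fun x => ENNReal.ofReal (‖Ψ (x + w)‖ ^ 2)) (hgm.comp (measurable_add_const w))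
    rw [← e1]
    simp only [sub_add_cancel]
    exact lintegral_mono_set (fun x hx => hA' x hx)
  have hmeas2 : Measurable (fun z : Config N × ℝ =>
      ENNReal.ofReal (4 * s ^ 2) * ENNReal.ofReal (DSq N α j Ψ (z.1 + z.2 • w) + DSq N α k Ψ (z.1 + z.2 • w))) := by
    apply Measurable.const_mul
    exact ENNReal.measurable_ofReal.comp
      (hDc.comp (by fun_prop : Continuous fun z : Config N × ℝ => z.1 + z.2 • w)).measurable
  have step2 : ∫⁻ x in A, ∫⁻ t in Set.Ioc (0 : ℝ) 1,
      ENNReal.ofReal (4 * s ^ 2) * ENNReal.ofReal (DSq N α j Ψ (x + t • w) + DSq N α k Ψ (x + t • w))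
      ≤ ENNReal.ofReal (4 * s ^ 2) *
        ∫⁻ x in P, ENNReal.ofReal (DSq N α j Ψ x + DSq N α k Ψ x) := by
    rw [lintegral_lintegral_swap hmeas2.aemeasurable]
    calc _ ≤ ∫⁻ t in Set.Ioc (0 : ℝ) 1, (ENNReal.ofReal (4 * s ^ 2) *
        ∫⁻ x in P, ENNReal.ofReal (DSq N α j Ψ x + DSq N α k Ψ x)) := by
          refine setLIntegral_mono_ae' measurableSet_Ioc (Filter.Eventually.of_forall fun t ht => ?_)
          rw [lintegral_const_mul']
          swap
          · exact ENNReal.ofReal_ne_top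
          refine mul_le_mul' le_rfl ?_
          have mp : MeasurePreserving (fun x : Config N => x + t • w) volume volume :=
            measurePreserving_add_right volume (t • w)
          rw [← mp.setLIntegral_comp_preimage hP hDm]
          exact lintegral_mono_set (fun x hx => hsub x hx t ht)
      _ = _ := by simp
  refine step1.trans ?_
  calc ∫⁻ x in A, ENNReal.ofReal (‖Ψ (x + w)‖ ^ 2)
      ≤ ∫⁻ x in A, ENNReal.ofReal (Real.exp 1) * (ENNReal.ofReal (‖Ψ x‖ ^ 2)
        + ∫⁻ t in Set.Ioc (0 : ℝ) 1, ENNReal.ofReal (4 * s ^ 2)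
            * ENNReal.ofReal (DSq N α j Ψ (x + t • w) + DSq N α k Ψ (x + t • w))) := by
        refine lintegral_mono fun x => (poinc_point h α j k x v v').trans ?_
        gcongr with t
        rw [← ENNReal.ofReal_mul (by positivity)]
        apply ENNReal.ofReal_le_ofReal
        apply mul_le_mul_of_nonneg_right hv
        exact add_nonneg (DSq_nonneg _ _ _ _) (DSq_nonneg _ _ _ _)
    _ = ENNReal.ofReal (Real.exp 1) * ((∫⁻ x in A, ENNReal.ofReal (‖Ψ x‖ ^ 2)) +
        ∫⁻ x in A, ∫⁻ t in Set.Ioc (0 : ℝ) 1, ENNReal.ofReal (4 * s ^ 2)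
            * ENNReal.ofReal (DSq N α j Ψ (x + t • w) + DSq N α k Ψ (x + t • w))) := by
        rw [lintegral_const_mul' _ _ ENNReal.ofReal_ne_top, lintegral_add_left hgm]
    _ ≤ _ := by gcongr


/-- Product region with particles `j`, `k` in `S`, its companion and the others in `O l`. -/
def reg {N : ℕ} (j k : Fin N) (O : Fin N → Set Plane) (S S' : Set Plane) : Set (Config N) :=
  {x | x j ∈ S ∧ x k ∈ S' ∧ ∀ l, l ≠ j → l ≠ k → x l ∈ O l}

lemma measurableSet_reg {N : ℕ} (j k : Fin N) (O : Fin N → Set Plane) (S S' : Set Plane)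
    (hO : ∀ l, MeasurableSet (O l)) (hS : MeasurableSet S) (hS' : MeasurableSet S') :
    MeasurableSet (reg j k O S S') := by
  have : reg j k O S S' = (fun x : Config N => x j) ⁻¹' S ∩ ((fun x : Config N => x k) ⁻¹' S' ∩
      ⋂ l : Fin N, ⋂ _ : l ≠ j, ⋂ _ : l ≠ k, (fun x : Config N => x l) ⁻¹' (O l)) := by
    ext x; simp [reg]
  rw [this]
  refine (measurable_pi_apply j hS).inter ((measurable_pi_apply k hS').inter ?_)
  refine MeasurableSet.iInter fun l => MeasurableSet.iInter fun _ => MeasurableSet.iInter fun _ => ?_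
  exact measurable_pi_apply l (hO l)

/-- Cells of the 16 by 16 grid. -/
def cell (a : Plane) (s : ℝ) (i : Fin 16 × Fin 16) : Set Plane :=
  box (a.1 + (i.1 : ℕ) * (s / 16), a.2 + (i.2 : ℕ) * (s / 16)) (s / 16)

lemma exists_cell_coord {a s p : ℝ} (hs : 0 < s) (h1 : a ≤ p) (h2 : p < a + s) :
    ∃ i : Fin 16, a + (i : ℕ) * (s / 16) ≤ p ∧ p < a + (i : ℕ) * (s / 16) + s / 16 := by
  have hs16 : 0 < s / 16 := by positivity
  have h0 : 0 ≤ (p - a) / (s / 16) := div_nonneg (by linarith) hs16.le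
  have hfl := Nat.floor_le h0
  have hfl2 := Nat.lt_floor_add_one ((p - a) / (s / 16))
  have hlt : ⌊(p - a) / (s / 16)⌋₊ < 16 := by
    rw [Nat.floor_lt h0, div_lt_iff₀ hs16]
    push_cast; linarith
  refine ⟨⟨_, hlt⟩, ?_, ?_⟩
  · rw [le_div_iff₀ hs16] at hfl
    simp only; linarith
  · rw [div_lt_iff₀ hs16] at hfl2
    simp only; linarith

lemma exists_cell {a : Plane} {s : ℝ} (hs : 0 < s) {p : Plane} (hp : p ∈ box a s) :
    ∃ i, p ∈ cell a s i := by
  rw [mem_box] at hp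
  obtain ⟨i, hi⟩ := exists_cell_coord hs hp.1.1 hp.1.2
  obtain ⟨i', hi'⟩ := exists_cell_coord hs hp.2.1 hp.2.2
  exact ⟨(i, i'), by rw [cell, mem_box]; exact ⟨hi, hi'⟩⟩

lemma cell_coord_bound (i : Fin 16) {s : ℝ} (hs : 0 < s) :
    0 ≤ (i : ℕ) * (s / 16) ∧ (i : ℕ) * (s / 16) + s / 16 ≤ s := by
  have h : ((i : ℕ) : ℝ) + 1 ≤ 16 := by exact_mod_cast i.2
  constructor
  · positivity
  · nlinarith

lemma cell_subset {a : Plane} {s : ℝ} (hs : 0 < s) (i : Fin 16 × Fin 16) :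
    cell a s i ⊆ box a s := by
  intro p hp
  rw [cell, mem_box] at hp
  rw [mem_box]
  have h1 := cell_coord_bound i.1 hs
  have h2 := cell_coord_bound i.2 hs
  simp only at hp
  refine ⟨⟨?_, ?_⟩, ?_, ?_⟩ <;> linarith [hp.1.1, hp.1.2, hp.2.1, hp.2.2]

lemma segment_coord {l u x v t : ℝ} (h1 : l ≤ x) (h2 : x < u) (h3 : l ≤ x + v) (h4 : x + v < u)
    (ht0 : 0 < t) (ht1 : t ≤ 1) : l ≤ x + t * v ∧ x + t * v < u := by
  constructor
  · nlinarith
  · nlinarith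

lemma segment_box {a : Plane} {s : ℝ} {x v : Plane} (h : x ∈ box a s) (h' : x + v ∈ box a s)
    {t : ℝ} (ht0 : 0 < t) (ht1 : t ≤ 1) : x + t • v ∈ box a s := by
  rw [mem_box] at *
  simp only [Prod.fst_add, Prod.snd_add, Prod.smul_fst, Prod.smul_snd, smul_eq_mul] at *
  exact ⟨segment_coord h.1.1 h.1.2 h'.1.1 h'.1.2 ht0 ht1,
    segment_coord h.2.1 h.2.2 h'.2.1 h'.2.2 ht0 ht1⟩

/-- Shift between two cells. -/
def shift (s : ℝ) (i i0 : Fin 16 × Fin 16) : Plane :=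
  (((i.1 : ℕ) - (i0.1 : ℕ) : ℝ) * (s / 16), ((i.2 : ℕ) - (i0.2 : ℕ) : ℝ) * (s / 16))

lemma add_shift_mem {a : Plane} {s : ℝ} {i i0 : Fin 16 × Fin 16} {p : Plane} :
    p + shift s i i0 ∈ cell a s i ↔ p ∈ cell a s i0 := by
  simp only [cell, mem_box, shift, Prod.fst_add, Prod.snd_add]
  constructor <;> rintro ⟨⟨h1, h2⟩, h3, h4⟩ <;> refine ⟨⟨?_, ?_⟩, ?_, ?_⟩ <;> linarith

lemma shift_sq_le {s : ℝ} (hs : 0 < s) (i i0 : Fin 16 × Fin 16) :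
    (shift s i i0).1 ^ 2 + (shift s i i0).2 ^ 2 ≤ 2 * s ^ 2 := by
  have h1 := cell_coord_bound i.1 hs
  have h2 := cell_coord_bound i.2 hs
  have h3 := cell_coord_bound i0.1 hs
  have h4 := cell_coord_bound i0.2 hs
  have e1 : (shift s i i0).1 ^ 2 ≤ s ^ 2 := by
    apply sq_le_sq'
    · simp only [shift]; linarith
    · simp only [shift]; linarith
  have e2 : (shift s i i0).2 ^ 2 ≤ s ^ 2 := by
    apply sq_le_sq'
    · simp only [shift]; linarith
    · simp only [shift]; linarith
  linarith

lemma pair_apply_j {N : ℕ} {j k : Fin N} (hjk : j ≠ k) (v v' : Plane) :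
    (Pi.single j v + Pi.single k v' : Config N) j = v := by
  simp [hjk]

lemma pair_apply_k {N : ℕ} {j k : Fin N} (hjk : j ≠ k) (v v' : Plane) :
    (Pi.single j v + Pi.single k v' : Config N) k = v' := by
  simp [hjk.symm]

lemma pair_apply_l {N : ℕ} {j k l : Fin N} (hj : l ≠ j) (hk : l ≠ k) (v v' : Plane) :
    (Pi.single j v + Pi.single k v' : Config N) l = 0 := by
  simp [hj, hk]

lemma poinc_box {N : ℕ} {Ψ : Config N → ℂ} (h : Admissible N Ψ) (α : ℝ) {j k : Fin N} (hjk : j ≠ k)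
    (O : Fin N → Set Plane) (hO : ∀ l, MeasurableSet (O l)) (a : Plane) {s : ℝ} (hs : 0 < s)
    (i0 : Fin 16 × Fin 16) :
    ∫⁻ x in reg j k O (box a s) (box a s), ENNReal.ofReal (‖Ψ x‖ ^ 2) ≤
      65536 * (ENNReal.ofReal (Real.exp 1) *
      ((∫⁻ x in reg j k O (cell a s i0) (cell a s i0), ENNReal.ofReal (‖Ψ x‖ ^ 2))
        + ENNReal.ofReal (4 * s ^ 2) *
        ∫⁻ x in reg j k O (box a s) (box a s), ENNReal.ofReal (DSq N α j Ψ x + DSq N α k Ψ x))) := by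
  set bd := (ENNReal.ofReal (Real.exp 1) *
      ((∫⁻ x in reg j k O (cell a s i0) (cell a s i0), ENNReal.ofReal (‖Ψ x‖ ^ 2))
        + ENNReal.ofReal (4 * s ^ 2) *
        ∫⁻ x in reg j k O (box a s) (box a s), ENNReal.ofReal (DSq N α j Ψ x + DSq N α k Ψ x))) with hbd
  have hcov : reg j k O (box a s) (box a s) ⊆
      ⋃ ii : (Fin 16 × Fin 16) × (Fin 16 × Fin 16), reg j k O (cell a s ii.1) (cell a s ii.2) := by
    rintro x ⟨h1, h2, h3⟩
    obtain ⟨i, hi⟩ := exists_cell hs h1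
    obtain ⟨i', hi'⟩ := exists_cell hs h2
    exact Set.mem_iUnion.2 ⟨(i, i'), hi, hi', h3⟩
  have hm : ∀ i, MeasurableSet (cell a s i) := fun i => measurableSet_box _ _
  have hone : ∀ ii : (Fin 16 × Fin 16) × (Fin 16 × Fin 16),
      ∫⁻ x in reg j k O (cell a s ii.1) (cell a s ii.2), ENNReal.ofReal (‖Ψ x‖ ^ 2) ≤ bd := by
    rintro ⟨i, i'⟩
    refine poinc_translate h α j k _ _ _ (measurableSet_reg j k O _ _ hO (hm i0) (hm i0))
      (measurableSet_reg j k O _ _ hO (measurableSet_box a s) (measurableSet_box a s))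
      (shift s i i0) (shift s i' i0) ?_ ?_ ?_
    · linarith [shift_sq_le hs i i0, shift_sq_le hs i' i0]
    · rintro x ⟨h1, h2, h3⟩
      refine ⟨?_, ?_, fun l hj hk => ?_⟩
      · rw [Pi.sub_apply, pair_apply_j hjk, ← add_shift_mem (i := i), sub_add_cancel]; exact h1
      · rw [Pi.sub_apply, pair_apply_k hjk, ← add_shift_mem (i := i'), sub_add_cancel]; exact h2
      · rw [Pi.sub_apply, pair_apply_l hj hk, sub_zero]; exact h3 l hj hk
    · rintro x ⟨h1, h2, h3⟩ t ⟨ht0, ht1⟩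
      refine ⟨?_, ?_, fun l hj hk => ?_⟩
      · rw [Pi.add_apply, Pi.smul_apply, pair_apply_j hjk]
        exact segment_box (cell_subset hs _ h1) (cell_subset hs i (add_shift_mem.2 h1)) ht0 ht1
      · rw [Pi.add_apply, Pi.smul_apply, pair_apply_k hjk]
        exact segment_box (cell_subset hs _ h2) (cell_subset hs i' (add_shift_mem.2 h2)) ht0 ht1
      · rw [Pi.add_apply, Pi.smul_apply, pair_apply_l hj hk, smul_zero, add_zero]; exact h3 l hj hk
  calc _ ≤ ∫⁻ x in ⋃ ii : (Fin 16 × Fin 16) × (Fin 16 × Fin 16),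
        reg j k O (cell a s ii.1) (cell a s ii.2), ENNReal.ofReal (‖Ψ x‖ ^ 2) := lintegral_mono_set hcov
    _ ≤ ∑' ii : (Fin 16 × Fin 16) × (Fin 16 × Fin 16),
        ∫⁻ x in reg j k O (cell a s ii.1) (cell a s ii.2), ENNReal.ofReal (‖Ψ x‖ ^ 2) :=
        lintegral_iUnion_le _ _
    _ = ∑ ii : (Fin 16 × Fin 16) × (Fin 16 × Fin 16),
        ∫⁻ x in reg j k O (cell a s ii.1) (cell a s ii.2), ENNReal.ofReal (‖Ψ x‖ ^ 2) := tsum_fintype _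
    _ ≤ ∑ ii : (Fin 16 × Fin 16) × (Fin 16 × Fin 16), bd := Finset.sum_le_sum fun ii _ => hone ii
    _ = 65536 * bd := by
        rw [Finset.sum_const, Finset.card_univ, nsmul_eq_mul]
        simp only [Fintype.card_prod, Fintype.card_fin]
        norm_num


/-- Squared distance of particles `j`, `k`. -/
def rsq {N : ℕ} (j k : Fin N) (x : Config N) : ℝ :=
  ((x j).1 - (x k).1) ^ 2 + ((x j).2 - (x k).2) ^ 2

lemma rsq_continuous {N : ℕ} (j k : Fin N) : Continuous (rsq (N := N) j k) := by
  unfold rsq; fun_prop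

lemma rsq_nonneg {N : ℕ} (j k : Fin N) (x : Config N) : 0 ≤ rsq j k x := by
  unfold rsq; positivity

/-- Dilation of particle `j` towards particle `k`. -/
def dil {N : ℕ} (j k : Fin N) (t : ℝ) : Config N →ₗ[ℝ] Config N where
  toFun x := x + (t - 1) • (Pi.single j (x j - x k) : Config N)
  map_add' x y := by
    ext l <;> by_cases h : l = j
    · subst h; simp; ring
    · simp [h]
    · subst h; simp; ring
    · simp [h]
  map_smul' c x := by
    ext l <;> by_cases h : l = j
    · subst h; simp; ring
    · simp [h]
    · subst h; simp; ring
    · simp [h]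

/-- Shear. -/
def shear {N : ℕ} (j k : Fin N) (hjk : j ≠ k) : Config N ≃ₗ[ℝ] Config N where
  toFun x := x + Pi.single j (x k)
  invFun x := x - Pi.single j (x k)
  map_add' x y := by
    ext l <;> by_cases h : l = j
    · subst h; simp; ring
    · simp [h]
    · subst h; simp; ring
    · simp [h]
  map_smul' c x := by
    ext l <;> by_cases h : l = j
    · subst h; simp
    · simp [h]
    · subst h; simp
    · simp [h]
  left_inv x := by
    ext l <;> by_cases h : l = j
    · subst h; simp [hjk.symm]
    · simp [h]
    · subst h; simp [hjk.symm]
    · simp [h]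
  right_inv x := by
    ext l <;> by_cases h : l = j
    · subst h; simp [hjk.symm]
    · simp [h]
    · subst h; simp [hjk.symm]
    · simp [h]

lemma dil_det {N : ℕ} {j k : Fin N} (hjk : j ≠ k) (t : ℝ) : LinearMap.det (dil j k t) = t ^ 2 := by
  have h1 : dil j k t = (shear j k hjk : Config N →ₗ[ℝ] Config N) ∘ₗ
      (LinearMap.pi fun i => (if i = j then t • LinearMap.id else LinearMap.id) ∘ₗ LinearMap.proj i)
      ∘ₗ ((shear j k hjk).symm : Config N →ₗ[ℝ] Config N) := by
    apply LinearMap.ext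
    intro x
    ext l <;> by_cases h : l = j
    · subst h; simp [dil, shear, hjk.symm]; ring
    · simp [dil, shear, h]
    · subst h; simp [dil, shear, hjk.symm]; ring
    · simp [dil, shear, h]
  rw [h1, LinearMap.det_conj, LinearMap.det_pi]
  have : ∀ i : Fin N, LinearMap.det (if i = j then t • LinearMap.id else LinearMap.id : Plane →ₗ[ℝ] Plane)
      = if i = j then t ^ 2 else 1 := by
    intro i
    split_ifs
    · rw [LinearMap.det_smul]; simp
    · simp
  simp only [this]
  simp

lemma dil_apply_j {N : ℕ} (j k : Fin N) (t : ℝ) (x : Config N) :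
    dil j k t x j = x j + (t - 1) • (x j - x k) := by
  simp [dil]

lemma dil_apply_l {N : ℕ} {j l : Fin N} (k : Fin N) (hl : l ≠ j) (t : ℝ) (x : Config N) :
    dil j k t x l = x l := by
  simp [dil, hl]

lemma rsq_dil {N : ℕ} {j k : Fin N} (hjk : j ≠ k) (t : ℝ) (x : Config N) :
    rsq j k (dil j k t x) = t ^ 2 * rsq j k x := by
  unfold rsq
  rw [dil_apply_j, dil_apply_l k hjk.symm]
  simp
  ring

lemma Admissible.zero_of_eq {N : ℕ} {Ψ : Config N → ℂ} (h : Admissible N Ψ) {j k : Fin N}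
    (hjk : j ≠ k) {x : Config N} (hx : x j = x k) : Ψ x = 0 := by
  obtain ⟨U, hU, hd, hz⟩ := h.vanishes
  exact hz x (hd ⟨j, k, hjk, hx⟩)

/-- The density appearing in the radial estimate. -/
def hdens {N : ℕ} (α : ℝ) (j k : Fin N) (Ψ : Config N → ℂ) (x : Config N) : ℝ :=
  DSq N α j Ψ x / α + α * ‖Ψ x‖ ^ 2 / rsq j k x

lemma hdens_nonneg {N : ℕ} {α : ℝ} (hα : 0 < α) (j k : Fin N) (Ψ : Config N → ℂ) (x : Config N) :
    0 ≤ hdens α j k Ψ x := by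
  unfold hdens
  have := DSq_nonneg Ψ α j x
  have := rsq_nonneg j k x
  positivity

lemma hdens_measurable {N : ℕ} (α : ℝ) (j k : Fin N) {Ψ : Config N → ℂ} (h : Admissible N Ψ) :
    Measurable (hdens α j k Ψ) := by
  unfold hdens
  exact ((DSq_continuous h α j).measurable.div_const α).add
    (((h.continuous.norm.pow 2).measurable.const_mul α).div (rsq_continuous j k).measurable)

lemma radial_point {N : ℕ} {Ψ : Config N → ℂ} (h : Admissible N Ψ) {α : ℝ} (hα : 0 < α)
    {j k : Fin N} (hjk : j ≠ k) (x : Config N) :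
    ENNReal.ofReal (‖Ψ x‖ ^ 2) ≤ ∫⁻ t in Set.Ioc (0 : ℝ) 1,
      ENNReal.ofReal (1 / t * (rsq j k (dil j k t x) * hdens α j k Ψ (dil j k t x))) := by
  set w : Config N := Pi.single j (x j - x k) with hw
  have hγe : ∀ t : ℝ, dil j k t x = x + (t - 1) • w := fun t => rfl
  have hγ : ∀ t : ℝ, HasDerivAt (fun t : ℝ => dil j k t x) w t := by
    intro t
    simp only [hγe]
    simpa using (((hasDerivAt_id t).sub_const 1).smul_const w).const_add x
  have hγc : Continuous (fun t : ℝ => dil j k t x) := by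
    simp only [hγe]; fun_prop
  have key := ftc_lintegral_le (F := fun t => ‖Ψ (dil j k t x)‖ ^ 2)
    (F' := fun t => gder Ψ (dil j k t x) w)
    (b := fun t => 1 / t * (rsq j k (dil j k t x) * hdens α j k Ψ (dil j k t x)))
    zero_le_one (fun t _ => gder_hasDerivAt h (hγ t))
    (gder_continuous h hγc continuous_const).continuousOn ?_
  · have h0 : Ψ (dil j k 0 x) = 0 := by
      apply h.zero_of_eq hjk
      rw [dil_apply_j, dil_apply_l k hjk.symm]; simp
    have h1 : dil j k 1 x = x := by rw [hγe]; simp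
    simpa [h0, h1] using key
  · rintro t ⟨ht0, ht1⟩
    set y := dil j k t x with hy
    have h1 := gder_abs_le Ψ α j k y (x j - x k) 0
    have hw' : (Pi.single j (x j - x k) + Pi.single k 0 : Config N) = w := by simp [hw]
    rw [hw'] at h1
    have h2 := D2_norm_sq_le_left Ψ α j k y (x j - x k)
    have h3 := (le_abs_self _).trans h1
    have hr : (x j - x k).1 ^ 2 + (x j - x k).2 ^ 2 = rsq j k x := rfl
    rw [hr] at h2
    have hq : rsq j k y = t ^ 2 * rsq j k x := rsq_dil hjk t x
    set d := ‖D2 N α j k Ψ y (x j - x k) 0‖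
    have hd : 0 ≤ d := norm_nonneg _
    have hD := DSq_nonneg Ψ α j y
    rcases (rsq_nonneg j k x).eq_or_lt with h0 | h0
    · rw [← h0, zero_mul] at h2
      have hd0 : d = 0 := by nlinarith
      rw [hd0, mul_zero] at h3
      rw [hq, ← h0]; simpa using h3
    · have e : 1 / t * (rsq j k y * hdens α j k Ψ y)
          = t / α * (rsq j k x * DSq N α j Ψ y) + α / t * ‖Ψ y‖ ^ 2 := by
        unfold hdens
        rw [hq]
        field_simp
      rw [e]
      have e2 : t / α * d ^ 2 ≤ t / α * (rsq j k x * DSq N α j Ψ y) := by gcongr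
      have e3 : t / α * d ^ 2 + α / t * ‖Ψ y‖ ^ 2 - 2 * ‖Ψ y‖ * d
          = (t * d - α * ‖Ψ y‖) ^ 2 / (α * t) := by
        field_simp
        ring
      have e4 : 0 ≤ (t * d - α * ‖Ψ y‖) ^ 2 / (α * t) := by positivity
      linarith

lemma radial_weight {q ρ : ℝ} (hq : 0 < q) (hρ : 0 < ρ) :
    ∫⁻ t in Set.Ioc (0 : ℝ) 1, (if q < t ^ 2 * ρ ^ 2 then ENNReal.ofReal (t ^ (-3 : ℝ)) else 0)
      ≤ ENNReal.ofReal (ρ ^ 2 / (2 * q)) := by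
  set τ := √q / ρ with hτ
  have hτ0 : 0 < τ := by positivity
  have hτ2 : τ ^ 2 = q / ρ ^ 2 := by rw [hτ, div_pow, Real.sq_sqrt hq.le]
  have hi := integrableOn_Ioi_rpow_of_lt (by norm_num : (-3 : ℝ) < -1) hτ0
  have hv := integral_Ioi_rpow_of_lt (by norm_num : (-3 : ℝ) < -1) hτ0
  have hval : -τ ^ ((-3 : ℝ) + 1) / ((-3 : ℝ) + 1) = ρ ^ 2 / (2 * q) := by
    have : ((-3 : ℝ) + 1) = -((2 : ℕ) : ℝ) := by norm_num
    rw [this, Real.rpow_neg hτ0.le, Real.rpow_natCast, hτ2]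
    push_cast
    field_simp
  rw [hval] at hv
  rw [← hv, ofReal_integral_eq_lintegral_ofReal hi]
  · rw [← lintegral_indicator measurableSet_Ioc, ← lintegral_indicator measurableSet_Ioi]
    refine lintegral_mono fun t => ?_
    by_cases ht : t ∈ Set.Ioc (0 : ℝ) 1
    · rw [Set.indicator_of_mem ht]
      split_ifs with hc
      · rw [Set.indicator_of_mem]
        rw [Set.mem_Ioi]
        apply lt_of_pow_lt_pow_left₀ 2 ht.1.le
        rw [hτ2, div_lt_iff₀ (by positivity)]
        exact hc
      · exact zero_le
    · rw [Set.indicator_of_notMem ht]; exact zero_le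
  · refine (ae_restrict_iff' measurableSet_Ioi).2 (Filter.Eventually.of_forall fun t ht => ?_)
    exact Real.rpow_nonneg (hτ0.le.trans (le_of_lt ht)) _

lemma radial {N : ℕ} {Ψ : Config N → ℂ} (h : Admissible N Ψ) {α : ℝ} (hα : 0 < α)
    {j k : Fin N} (hjk : j ≠ k) (W : Set (Config N)) (hW : MeasurableSet W)
    {ρ : ℝ} (hρ : 0 < ρ) (hWr : ∀ x ∈ W, rsq j k x < ρ ^ 2)
    (hWd : ∀ x ∈ W, ∀ t ∈ Set.Ioc (0 : ℝ) 1, dil j k t x ∈ W) :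
    ∫⁻ x in W, ENNReal.ofReal (‖Ψ x‖ ^ 2)
      ≤ ENNReal.ofReal (ρ ^ 2 / 2) * ∫⁻ x in W, ENNReal.ofReal (hdens α j k Ψ x) := by
  set H : Config N → ENNReal := fun x => ENNReal.ofReal (rsq j k x * hdens α j k Ψ x) with hH
  have hHm : Measurable H :=
    ENNReal.measurable_ofReal.comp ((rsq_continuous j k).measurable.mul (hdens_measurable α j k h))
  have hdc : Continuous (fun z : Config N × ℝ => dil j k z.2 z.1) := by
    have : (fun z : Config N × ℝ => dil j k z.2 z.1)
        = fun z => z.1 + (z.2 - 1) • (Pi.single j (z.1 j - z.1 k) : Config N) := rfl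
    rw [this]
    have hc0 : Continuous (fun z : Config N × ℝ => z.2 - 1) := by fun_prop
    refine continuous_fst.add (hc0.smul ?_)
    have hc : Continuous (fun z : Config N × ℝ => z.1 j - z.1 k) := by fun_prop
    exact (continuous_single (A := fun _ : Fin N => Plane) j).comp hc
  have hm1 : Measurable (fun z : Config N × ℝ =>
      ENNReal.ofReal (1 / z.2 * (rsq j k (dil j k z.2 z.1) * hdens α j k Ψ (dil j k z.2 z.1)))) := by
    apply ENNReal.measurable_ofReal.comp
    refine (measurable_const.div measurable_snd).mul ?_
    exact ((rsq_continuous j k).measurable.mul (hdens_measurable α j k h)).comp hdc.measurable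
  have hm2 : Measurable (fun z : ℝ × Config N =>
      (if rsq j k z.2 < z.1 ^ 2 * ρ ^ 2 then ENNReal.ofReal (z.1 ^ (-3 : ℝ)) else 0) * H z.2) := by
    refine Measurable.mul ?_ (hHm.comp measurable_snd)
    refine Measurable.ite ?_ ?_ measurable_const
    · exact measurableSet_lt ((rsq_continuous j k).measurable.comp measurable_snd)
        ((measurable_fst.pow_const 2).mul_const _)
    · exact ENNReal.measurable_ofReal.comp (measurable_fst.pow_const _)
  calc ∫⁻ x in W, ENNReal.ofReal (‖Ψ x‖ ^ 2)
      ≤ ∫⁻ x in W, ∫⁻ t in Set.Ioc (0 : ℝ) 1,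
      ENNReal.ofReal (1 / t * (rsq j k (dil j k t x) * hdens α j k Ψ (dil j k t x))) :=
        lintegral_mono fun x => radial_point h hα hjk x
    _ = ∫⁻ t in Set.Ioc (0 : ℝ) 1, ∫⁻ x in W,
      ENNReal.ofReal (1 / t * (rsq j k (dil j k t x) * hdens α j k Ψ (dil j k t x))) :=
        lintegral_lintegral_swap hm1.aemeasurable
    _ ≤ ∫⁻ t in Set.Ioc (0 : ℝ) 1, ∫⁻ x in W,
      (if rsq j k x < t ^ 2 * ρ ^ 2 then ENNReal.ofReal (t ^ (-3 : ℝ)) else 0) * H x := by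
        refine setLIntegral_mono_ae' measurableSet_Ioc (Filter.Eventually.of_forall fun t ht => ?_)
        have ht0 : 0 < t := ht.1
        have e1 : ∀ x, ENNReal.ofReal (1 / t * (rsq j k (dil j k t x) * hdens α j k Ψ (dil j k t x)))
            = ENNReal.ofReal (1 / t) * H (dil j k t x) := fun x =>
          ENNReal.ofReal_mul (by positivity)
        simp only [e1]
        rw [lintegral_const_mul' _ _ ENNReal.ofReal_ne_top]
        set A : Set (Config N) := W ∩ {x | rsq j k x < t ^ 2 * ρ ^ 2} with hA
        have hAm : MeasurableSet A :=
          hW.inter (measurableSet_lt (rsq_continuous j k).measurable measurable_const)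
        have hdet : LinearMap.det (dil j k t) ≠ 0 := by rw [dil_det hjk]; positivity
        have hmap := Measure.map_linearMap_addHaar_eq_smul_addHaar (volume : Measure (Config N)) hdet
        have hmd : Measurable (dil j k t : Config N → Config N) :=
          (hdc.comp (Continuous.prodMk continuous_id continuous_const)).measurable
        have e2 : ∫⁻ x in W, H (dil j k t x) ≤ ∫⁻ x, A.indicator H (dil j k t x) := by
          rw [← lintegral_indicator hW]
          refine lintegral_mono fun x => ?_
          by_cases hx : x ∈ W
          · have : dil j k t x ∈ A := by
              refine ⟨hWd x hx t ht, ?_⟩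
              show rsq j k _ < _
              rw [rsq_dil hjk]
              have := hWr x hx
              gcongr
            rw [Set.indicator_of_mem hx, Set.indicator_of_mem this]
          · rw [Set.indicator_of_notMem hx]; exact zero_le
        have e3 : ∫⁻ x, A.indicator H (dil j k t x) = ENNReal.ofReal ((t ^ 2)⁻¹) * ∫⁻ x in A, H x := by
          rw [← lintegral_map (hHm.indicator hAm) hmd, hmap, lintegral_smul_measure,
            lintegral_indicator hAm, dil_det hjk, abs_of_pos (by positivity)]
          rfl
        have e4 : ENNReal.ofReal (1 / t) * ENNReal.ofReal ((t ^ 2)⁻¹) = ENNReal.ofReal (t ^ (-3 : ℝ)) := by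
          rw [← ENNReal.ofReal_mul (by positivity)]
          congr 1
          have : (-3 : ℝ) = -((3 : ℕ) : ℝ) := by norm_num
          rw [this, Real.rpow_neg ht0.le, Real.rpow_natCast]
          field_simp
        calc ENNReal.ofReal (1 / t) * ∫⁻ x in W, H (dil j k t x)
            ≤ ENNReal.ofReal (1 / t) * (ENNReal.ofReal ((t ^ 2)⁻¹) * ∫⁻ x in A, H x) :=
              mul_le_mul' le_rfl (e2.trans e3.le)
          _ = ENNReal.ofReal (t ^ (-3 : ℝ)) * ∫⁻ x in A, H x := by rw [← mul_assoc, e4]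
          _ = ∫⁻ x in A, ENNReal.ofReal (t ^ (-3 : ℝ)) * H x :=
              (lintegral_const_mul' _ _ ENNReal.ofReal_ne_top).symm
          _ = ∫⁻ x in A, (if rsq j k x < t ^ 2 * ρ ^ 2 then ENNReal.ofReal (t ^ (-3 : ℝ)) else 0) * H x := by
              refine setLIntegral_congr_fun hAm fun x hx => ?_
              have : rsq j k x < t ^ 2 * ρ ^ 2 := hx.2
              simp only [this, if_true]
          _ ≤ _ := lintegral_mono_set Set.inter_subset_left
    _ = ∫⁻ x in W, ∫⁻ t in Set.Ioc (0 : ℝ) 1,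
      (if rsq j k x < t ^ 2 * ρ ^ 2 then ENNReal.ofReal (t ^ (-3 : ℝ)) else 0) * H x :=
        lintegral_lintegral_swap hm2.aemeasurable
    _ ≤ ∫⁻ x in W, ENNReal.ofReal (ρ ^ 2 / 2) * ENNReal.ofReal (hdens α j k Ψ x) := by
        refine lintegral_mono fun x => ?_
        simp only
        rw [lintegral_mul_const' _ _ ENNReal.ofReal_ne_top]
        rcases (rsq_nonneg j k x).eq_or_lt with h0 | h0
        · simp [hH, ← h0]
        · refine (mul_le_mul' (radial_weight h0 hρ) le_rfl).trans ?_
          rw [← ENNReal.ofReal_mul (by positivity), ← ENNReal.ofReal_mul (by positivity)]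
          apply ENNReal.ofReal_le_ofReal
          apply le_of_eq
          field_simp
    _ = _ := lintegral_const_mul' _ _ ENNReal.ofReal_ne_top


/-- A point of the plane as a complex number. -/
def toC (p : Plane) : ℂ := p.1 + p.2 * Complex.I

lemma toC_add (p q : Plane) : toC (p + q) = toC p + toC q := by
  simp [toC]; ring

lemma toC_sub (p q : Plane) : toC (p - q) = toC p - toC q := by
  simp [toC]; ring

lemma toC_normSq (p : Plane) : ‖toC p‖ ^ 2 = p.1 ^ 2 + p.2 ^ 2 := by
  rw [← Complex.normSq_eq_norm_sq, toC, Complex.normSq_add_mul_I]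

lemma perpInv_toC (u v : Plane) :
    (perpInv u).1 * v.1 + (perpInv u).2 * v.2 = (toC v / toC u).im := by
  rw [Complex.div_im, ]
  simp [toC, perpInv, Complex.normSq_add_mul_I]
  ring

/-- Displacement of the rotation. -/
def rotd (θ : ℝ) (r : Plane) : Plane :=
  (((Real.cos θ - 1) * r.1 - Real.sin θ * r.2) / 2, (Real.sin θ * r.1 + (Real.cos θ - 1) * r.2) / 2)

/-- Velocity of the rotation. -/
def rotv (θ : ℝ) (r : Plane) : Plane :=
  ((-Real.sin θ * r.1 - Real.cos θ * r.2) / 2, (Real.cos θ * r.1 - Real.sin θ * r.2) / 2)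

/-- Rotation of the pair `j`, `k` about its centre of mass. -/
def urot {N : ℕ} (j k : Fin N) (θ : ℝ) : Config N →ₗ[ℝ] Config N where
  toFun x := x + (Pi.single j (rotd θ (x j - x k)) + Pi.single k (-rotd θ (x j - x k)) : Config N)
  map_add' x y := by
    have e : rotd θ ((x + y) j - (x + y) k) = rotd θ (x j - x k) + rotd θ (y j - y k) := by
      ext <;> simp [rotd] <;> ring
    simp only [e, neg_add, Pi.single_add]
    abel
  map_smul' c x := by
    have e : rotd θ ((c • x) j - (c • x) k) = c • rotd θ (x j - x k) := by
      ext <;> simp [rotd] <;> ring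
    simp only [e, ← smul_neg, Pi.single_smul, smul_add, RingHom.id_apply]

lemma urot_apply {N : ℕ} (j k : Fin N) (θ : ℝ) (x : Config N) : urot j k θ x =
    x + (Pi.single j (rotd θ (x j - x k)) + Pi.single k (-rotd θ (x j - x k)) : Config N) := rfl

lemma urot_j {N : ℕ} {j k : Fin N} (hjk : j ≠ k) (θ : ℝ) (x : Config N) :
    urot j k θ x j = x j + rotd θ (x j - x k) := by
  rw [urot_apply, Pi.add_apply, pair_apply_j hjk]

lemma urot_k {N : ℕ} {j k : Fin N} (hjk : j ≠ k) (θ : ℝ) (x : Config N) :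
    urot j k θ x k = x k - rotd θ (x j - x k) := by
  rw [urot_apply, Pi.add_apply, pair_apply_k hjk, ← sub_eq_add_neg]

lemma urot_l {N : ℕ} {j k l : Fin N} (hj : l ≠ j) (hk : l ≠ k) (θ : ℝ) (x : Config N) :
    urot j k θ x l = x l := by
  rw [urot_apply, Pi.add_apply, pair_apply_l hj hk, add_zero]

lemma rsq_urot {N : ℕ} {j k : Fin N} (hjk : j ≠ k) (θ : ℝ) (x : Config N) :
    rsq j k (urot j k θ x) = rsq j k x := by
  unfold rsq
  rw [urot_j hjk, urot_k hjk]
  simp [rotd]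
  have := Real.sin_sq_add_cos_sq θ
  linear_combination (((x j).1 - (x k).1) ^ 2 + ((x j).2 - (x k).2) ^ 2) * this

lemma urot_comp {N : ℕ} {j k : Fin N} (hjk : j ≠ k) (θ : ℝ) :
    urot j k θ ∘ₗ urot j k (-θ) = LinearMap.id := by
  apply LinearMap.ext
  intro x
  have hsc := Real.sin_sq_add_cos_sq θ
  funext l
  rw [LinearMap.comp_apply, LinearMap.id_apply]
  by_cases hj : l = j
  · subst hj
    rw [urot_j hjk, urot_j hjk, urot_k hjk]
    ext
    · simp [rotd]
      linear_combination (((x l).1 - (x k).1)) / 2 * hsc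
    · simp [rotd]
      linear_combination (((x l).2 - (x k).2)) / 2 * hsc
  by_cases hk : l = k
  · subst hk
    rw [urot_k hjk, urot_j hjk, urot_k hjk]
    ext
    · simp [rotd]
      linear_combination -(((x j).1 - (x l).1)) / 2 * hsc
    · simp [rotd]
      linear_combination -(((x j).2 - (x l).2)) / 2 * hsc
  · rw [urot_l hj hk, urot_l hj hk]

/-- Reflection of all the second coordinates. -/
def reflY (N : ℕ) : Config N ≃ₗ[ℝ] Config N where
  toFun x := fun l => ((x l).1, -(x l).2)
  invFun x := fun l => ((x l).1, -(x l).2)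
  map_add' x y := by
    funext l; ext <;> simp; ring
  map_smul' c x := by
    funext l; ext <;> simp
  left_inv x := by funext l; simp
  right_inv x := by funext l; simp

lemma reflY_apply {N : ℕ} (x : Config N) (l : Fin N) : reflY N x l = ((x l).1, -(x l).2) := rfl

lemma reflY_symm_apply {N : ℕ} (x : Config N) (l : Fin N) :
    (reflY N).symm x l = ((x l).1, -(x l).2) := rfl

lemma urot_conj {N : ℕ} {j k : Fin N} (hjk : j ≠ k) (θ : ℝ) :
    (reflY N : Config N →ₗ[ℝ] Config N) ∘ₗ urot j k θ ∘ₗ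
      ((reflY N).symm : Config N →ₗ[ℝ] Config N) = urot j k (-θ) := by
  apply LinearMap.ext
  intro x
  funext l
  simp only [LinearMap.comp_apply, LinearEquiv.coe_coe]
  rw [reflY_apply]
  by_cases hj : l = j
  · subst hj
    rw [urot_j hjk, urot_j hjk]
    ext <;> simp [rotd, reflY_symm_apply] <;> ring
  by_cases hk : l = k
  · subst hk
    rw [urot_k hjk, urot_k hjk]
    ext <;> simp [rotd, reflY_symm_apply] <;> ring
  · rw [urot_l hj hk, urot_l hj hk]
    simp [reflY_symm_apply]

lemma urot_det {N : ℕ} {j k : Fin N} (hjk : j ≠ k) (θ : ℝ) : |LinearMap.det (urot j k θ)| = 1 := by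
  have h1 : LinearMap.det (urot j k (-θ)) = LinearMap.det (urot j k θ) := by
    rw [← urot_conj hjk, LinearMap.det_conj]
  have h2 : LinearMap.det (urot j k θ) * LinearMap.det (urot j k (-θ)) = 1 := by
    rw [← LinearMap.det_comp, urot_comp hjk, LinearMap.det_id]
  rw [h1] at h2
  have h3 : |LinearMap.det (urot j k θ)| * |LinearMap.det (urot j k θ)| = 1 := by
    rw [abs_mul_abs_self, h2]
  nlinarith [abs_nonneg (LinearMap.det (urot j k θ))]

lemma urot_continuous {N : ℕ} (j k : Fin N) :
    Continuous (fun z : Config N × ℝ => urot j k z.2 z.1) := by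
  have : (fun z : Config N × ℝ => urot j k z.2 z.1) = fun z => z.1 +
      (Pi.single j (rotd z.2 (z.1 j - z.1 k)) + Pi.single k (-rotd z.2 (z.1 j - z.1 k)) : Config N) := rfl
  rw [this]
  have hc : Continuous (fun z : Config N × ℝ => rotd z.2 (z.1 j - z.1 k)) := by
    unfold rotd; fun_prop
  refine continuous_fst.add (Continuous.add ?_ ?_)
  · exact (continuous_single (A := fun _ : Fin N => Plane) j).comp hc
  · exact (continuous_single (A := fun _ : Fin N => Plane) k).comp hc.neg

lemma urot_measurePreserving {N : ℕ} {j k : Fin N} (hjk : j ≠ k) (θ : ℝ) :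
    MeasurePreserving (urot j k θ : Config N → Config N) volume volume := by
  have hm : Measurable (urot j k θ : Config N → Config N) :=
    ((urot_continuous j k).comp (Continuous.prodMk continuous_id continuous_const)).measurable
  refine ⟨hm, ?_⟩
  have hd := urot_det hjk θ
  have h0 : LinearMap.det (urot j k θ) ≠ 0 := by
    intro h; rw [h] at hd; simp at hd
  rw [Measure.map_linearMap_addHaar_eq_smul_addHaar _ h0, abs_inv, hd]
  simp

lemma urot_pi {N : ℕ} {j k : Fin N} (hjk : j ≠ k) (x : Config N) :
    urot j k π x = x ∘ Equiv.swap j k := by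
  funext l
  rw [Function.comp_apply]
  by_cases hj : l = j
  · subst hj
    rw [urot_j hjk, Equiv.swap_apply_left]
    ext <;> simp [rotd] <;> ring
  by_cases hk : l = k
  · subst hk
    rw [urot_k hjk, Equiv.swap_apply_right]
    ext <;> simp [rotd] <;> ring
  · rw [urot_l hj hk, Equiv.swap_apply_of_ne_of_ne hj hk]

lemma urot_zero {N : ℕ} (j k : Fin N) (x : Config N) : urot j k 0 x = x := by
  have h0 : rotd 0 (x j - x k) = 0 := by ext <;> simp [rotd]
  rw [urot_apply, h0]
  simp

lemma urot_hasDerivAt {N : ℕ} (j k : Fin N) (x : Config N) (θ : ℝ) :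
    HasDerivAt (fun θ => urot j k θ x)
      (Pi.single j (rotv θ (x j - x k)) + Pi.single k (-rotv θ (x j - x k))) θ := by
  set r := x j - x k with hr
  have hd : HasDerivAt (fun θ => rotd θ r) (rotv θ r) θ := by
    unfold rotd rotv
    refine HasDerivAt.prodMk ?_ ?_
    · have := ((((Real.hasDerivAt_cos θ).sub_const 1).mul_const r.1).sub
        ((Real.hasDerivAt_sin θ).mul_const r.2)).div_const 2
      exact this
    · have := (((Real.hasDerivAt_sin θ).mul_const r.1).add
        (((Real.hasDerivAt_cos θ).sub_const 1).mul_const r.2)).div_const 2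
      refine this.congr_deriv ?_
      ring
  have hsj : ∀ (i : Fin N) (f : ℝ → Plane) (f' : Plane), HasDerivAt f f' θ →
      HasDerivAt (fun θ => (Pi.single i (f θ) : Config N)) (Pi.single i f') θ := by
    intro i f f' hf
    rw [hasDerivAt_pi]
    intro l
    by_cases hl : l = i
    · subst hl; simpa using hf
    · simpa [hl] using hasDerivAt_const θ (0 : Plane)
  simp only [urot_apply]
  exact ((hsj j _ _ hd).add (hsj k _ _ hd.neg)).const_add x


/-- Half the relative coordinate, rotated. -/
def zrot {N : ℕ} (j k : Fin N) (x : Config N) (θ : ℝ) : ℂ :=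
  toC (x j - x k) / 2 * Complex.exp (θ * Complex.I)

/-- Relative position of the centre of mass of `j`, `k` and the particle `l`. -/
def crel {N : ℕ} (j k : Fin N) (x : Config N) (l : Fin N) : ℂ :=
  (toC (x j) + toC (x k)) / 2 - toC (x l)

lemma exp_mul_I_eq (θ : ℝ) :
    Complex.exp (θ * Complex.I) = (Real.cos θ : ℂ) + (Real.sin θ : ℂ) * Complex.I := by
  rw [Complex.exp_mul_I, Complex.ofReal_cos, Complex.ofReal_sin]

lemma toC_rotd (θ : ℝ) (r : Plane) :
    toC (rotd θ r) = toC r / 2 * Complex.exp (θ * Complex.I) - toC r / 2 := by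
  rw [exp_mul_I_eq]
  simp only [toC, rotd]
  push_cast
  linear_combination (-(r.2 : ℂ) * (Complex.sin θ) / 2) * Complex.I_sq

lemma toC_rotv (θ : ℝ) (r : Plane) :
    toC (rotv θ r) = Complex.I * (toC r / 2 * Complex.exp (θ * Complex.I)) := by
  rw [exp_mul_I_eq]
  simp only [toC, rotv]
  push_cast
  have := Complex.I_sq
  linear_combination (-(r.1 : ℂ) * (Complex.sin θ) / 2 - (r.2 : ℂ) * (Complex.cos θ) / 2
    - (r.2 : ℂ) * Complex.sin θ * Complex.I / 2) * Complex.I_sq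

lemma toC_neg (p : Plane) : toC (-p) = - toC p := by simp [toC]; ring

lemma zrot_normSq {N : ℕ} (j k : Fin N) (x : Config N) (θ : ℝ) :
    ‖zrot j k x θ‖ ^ 2 = rsq j k x / 4 := by
  unfold zrot
  rw [norm_mul, Complex.norm_exp_ofReal_mul_I, norm_div, mul_one, div_pow, toC_normSq]
  simp [rsq]
  norm_num

/-- The other particles. -/
def others {N : ℕ} (j k : Fin N) : Finset (Fin N) := (Finset.univ.erase j).erase k

lemma mem_others {N : ℕ} {j k l : Fin N} : l ∈ others j k ↔ l ≠ j ∧ l ≠ k := by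
  simp [others]; tauto

lemma potForm_urot {N : ℕ} {j k : Fin N} (hjk : j ≠ k) (x : Config N) (hr : 0 < rsq j k x)
    (hfar : ∀ l, l ≠ j → l ≠ k → rsq j k x / 4 < ‖crel j k x l‖ ^ 2) (θ : ℝ) :
    potForm N j k (urot j k θ x) (rotv θ (x j - x k)) (-rotv θ (x j - x k))
      = 1 + ∑ l ∈ others j k,
        (-2 * Complex.I * zrot j k x θ ^ 2 / (crel j k x l ^ 2 - zrot j k x θ ^ 2)).im := by
  set z := zrot j k x θ with hz
  set y := urot j k θ x with hy
  set v := rotv θ (x j - x k) with hv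
  have hvz : toC v = Complex.I * z := toC_rotv θ _
  have hz2 := zrot_normSq j k x θ
  rw [← hz] at hz2
  have hz0 : z ≠ 0 := by
    intro h; rw [h] at hz2; simp at hz2; linarith
  have hyj : toC (y j) = toC (x j) + (z - toC (x j - x k) / 2) := by
    rw [hy, urot_j hjk, toC_add, toC_rotd]; rfl
  have hyk : toC (y k) = toC (x k) - (z - toC (x j - x k) / 2) := by
    rw [hy, urot_k hjk, toC_sub, toC_rotd]; rfl
  have hsub := toC_sub (x j) (x k)
  have e1 : (abPot N j y).1 * v.1 + (abPot N j y).2 * v.2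
      = 1 / 2 + ∑ l ∈ others j k, (Complex.I * z / (crel j k x l + z)).im := by
    have : (abPot N j y).1 * v.1 + (abPot N j y).2 * v.2
        = ∑ l ∈ Finset.univ.erase j, (toC v / toC (y j - y l)).im := by
      simp only [abPot, Prod.fst_sum, Prod.snd_sum, Finset.sum_mul, ← Finset.sum_add_distrib,
        perpInv_toC]
    rw [this, ← Finset.add_sum_erase _ _ (Finset.mem_erase.2 ⟨hjk.symm, Finset.mem_univ k⟩)]
    congr 1
    · have : toC v / toC (y j - y k) = Complex.I / 2 := by
        have h2 : toC (y j - y k) = 2 * z := by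
          rw [toC_sub, hyj, hyk, hsub]; ring
        rw [h2, hvz]; field_simp
      rw [this]; simp
    · refine Finset.sum_congr rfl fun l hl => ?_
      obtain ⟨hlj, hlk⟩ := mem_others.1 hl
      have : toC (y j - y l) = crel j k x l + z := by
        rw [toC_sub, hyj, hsub, hy, urot_l hlj hlk, crel]; ring
      rw [this, hvz]
  have e2 : (abPot N k y).1 * (-v).1 + (abPot N k y).2 * (-v).2
      = 1 / 2 + ∑ l ∈ others j k, (-(Complex.I * z) / (crel j k x l - z)).im := by
    have : (abPot N k y).1 * (-v).1 + (abPot N k y).2 * (-v).2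
        = ∑ l ∈ Finset.univ.erase k, (toC (-v) / toC (y k - y l)).im := by
      simp only [abPot, Prod.fst_sum, Prod.snd_sum, Finset.sum_mul, ← Finset.sum_add_distrib,
        perpInv_toC]
    rw [this, ← Finset.add_sum_erase _ _ (Finset.mem_erase.2 ⟨hjk, Finset.mem_univ j⟩),
      Finset.erase_right_comm, toC_neg]
    congr 1
    · have : -toC v / toC (y k - y j) = Complex.I / 2 := by
        have h2 : toC (y k - y j) = -(2 * z) := by
          rw [toC_sub, hyj, hyk, hsub]; ring
        rw [h2, hvz]; field_simp
      rw [this]; simp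
    · refine Finset.sum_congr rfl fun l hl => ?_
      obtain ⟨hlj, hlk⟩ := mem_others.1 hl
      have : toC (y k - y l) = crel j k x l - z := by
        rw [toC_sub, hyk, hsub, hy, urot_l hlj hlk, crel]; ring
      rw [this, hvz]
  have e3 : potForm N j k y v (-v) = ((abPot N j y).1 * v.1 + (abPot N j y).2 * v.2)
      + ((abPot N k y).1 * (-v).1 + (abPot N k y).2 * (-v).2) := by
    unfold potForm; ring
  rw [e3, e1, e2]
  have e4 : ∑ l ∈ others j k, (Complex.I * z / (crel j k x l + z)).im
      + ∑ l ∈ others j k, (-(Complex.I * z) / (crel j k x l - z)).im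
      = ∑ l ∈ others j k, (-2 * Complex.I * z ^ 2 / (crel j k x l ^ 2 - z ^ 2)).im := by
    rw [← Finset.sum_add_distrib]
    refine Finset.sum_congr rfl fun l hl => ?_
    obtain ⟨hlj, hlk⟩ := mem_others.1 hl
    have hf := hfar l hlj hlk
    rw [← hz2] at hf
    set c := crel j k x l
    have h1 : c + z ≠ 0 := by
      intro h
      have : c = -z := by linear_combination h
      rw [this, norm_neg] at hf; exact lt_irrefl _ hf
    have h2 : c - z ≠ 0 := by
      intro h
      have : c = z := by linear_combination h
      rw [this] at hf; exact lt_irrefl _ hf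
    rw [← Complex.add_im]
    congr 1
    have h3 : c ^ 2 - z ^ 2 = (c + z) * (c - z) := by ring
    rw [h3]
    field_simp
    ring
  linarith

/-- The gauge phase. -/
def phaseB {N : ℕ} (j k : Fin N) (x : Config N) (θ : ℝ) : ℝ :=
  θ + ∑ l ∈ others j k, (Complex.log (1 - zrot j k x θ ^ 2 / crel j k x l ^ 2)).im

lemma zrot_pi_sq {N : ℕ} (j k : Fin N) (x : Config N) : zrot j k x π ^ 2 = zrot j k x 0 ^ 2 := by
  simp [zrot]

lemma phaseB_pi {N : ℕ} (j k : Fin N) (x : Config N) : phaseB j k x π = π + phaseB j k x 0 := by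
  unfold phaseB
  rw [zrot_pi_sq]; ring

lemma zrot_hasDerivAt {N : ℕ} (j k : Fin N) (x : Config N) (θ : ℝ) :
    HasDerivAt (zrot j k x) (Complex.I * zrot j k x θ) θ := by
  unfold zrot
  have h1 : HasDerivAt (fun θ : ℝ => (θ : ℂ) * Complex.I) (1 * Complex.I) θ :=
    (Complex.ofRealCLM.hasDerivAt (x := θ)).mul_const Complex.I
  refine (h1.cexp.const_mul (toC (x j - x k) / 2)).congr_deriv ?_
  ring

lemma phaseB_hasDerivAt {N : ℕ} {j k : Fin N} (x : Config N)
    (hfar : ∀ l, l ≠ j → l ≠ k → rsq j k x / 4 < ‖crel j k x l‖ ^ 2) (θ : ℝ) :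
    HasDerivAt (phaseB j k x) (1 + ∑ l ∈ others j k,
        (-2 * Complex.I * zrot j k x θ ^ 2 / (crel j k x l ^ 2 - zrot j k x θ ^ 2)).im) θ := by
  unfold phaseB
  refine (hasDerivAt_id θ).add (HasDerivAt.fun_sum fun l hl => ?_)
  obtain ⟨hlj, hlk⟩ := mem_others.1 hl
  have hf := hfar l hlj hlk
  rw [← zrot_normSq j k x θ] at hf
  set c := crel j k x l
  have hz := zrot_hasDerivAt j k x θ
  set z := zrot j k x θ with hzz
  have hc0 : c ≠ 0 := by
    intro h; rw [h] at hf; simp at hf; nlinarith [sq_nonneg ‖z‖]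
  have hlt : ‖z ^ 2 / c ^ 2‖ < 1 := by
    rw [norm_div, norm_pow, norm_pow, div_lt_one (by positivity)]; exact hf
  have hsl : 1 - z ^ 2 / c ^ 2 ∈ Complex.slitPlane := by
    have := Complex.mem_slitPlane_of_norm_lt_one (z := -(z ^ 2 / c ^ 2)) (by rwa [norm_neg])
    rwa [← sub_eq_add_neg] at this
  have h1 : HasDerivAt (fun θ : ℝ => 1 - zrot j k x θ ^ 2 / c ^ 2)
      (-(2 * z * (Complex.I * z) / c ^ 2)) θ := by
    have := ((hz.pow 2).div_const (c ^ 2)).const_sub 1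
    refine this.congr_deriv ?_
    simp
    rfl
  have h2 := h1.clog_real hsl
  have h3 : HasDerivAt (fun θ : ℝ => (Complex.log (1 - zrot j k x θ ^ 2 / c ^ 2)).im) _ θ :=
    Complex.imCLM.hasFDerivAt.comp_hasDerivAt θ h2
  refine h3.congr_deriv ?_
  rw [Complex.imCLM_apply]
  congr 1
  have h4 : c ^ 2 - z ^ 2 ≠ 0 := by
    intro h
    have : 1 - z ^ 2 / c ^ 2 = 0 := by field_simp; linear_combination h
    rw [this] at hsl; simp at hsl
  have h5 : 1 - z ^ 2 / c ^ 2 = (c ^ 2 - z ^ 2) / c ^ 2 := by field_simp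
  rw [h5]
  field_simp


lemma phase_gap {α : ℝ} (h0 : 0 ≤ α) (h1 : α ≤ 1) :
    4 * α ^ 2 ≤ ‖Complex.exp ((α * π : ℝ) * Complex.I) - 1‖ ^ 2 := by
  have hs : α ≤ Real.sin (α * π / 2) := by
    have := Real.mul_le_sin (x := α * π / 2) (by positivity) (by nlinarith [Real.pi_pos])
    have e : 2 / π * (α * π / 2) = α := by field_simp
    rwa [e] at this
  have e : ‖Complex.exp ((α * π : ℝ) * Complex.I) - 1‖ ^ 2 = 4 * Real.sin (α * π / 2) ^ 2 := by
    rw [← Complex.normSq_eq_norm_sq, exp_mul_I_eq]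
    have h3 := Real.cos_sq_add_sin_sq (α * π)
    have h4 : Real.cos (α * π) = 1 - 2 * Real.sin (α * π / 2) ^ 2 := by
      have := Real.cos_two_mul (α * π / 2)
      have h5 := Real.sin_sq_add_cos_sq (α * π / 2)
      have h6 : 2 * (α * π / 2) = α * π := by ring
      rw [h6] at this
      linarith
    rw [Complex.normSq_apply]
    simp only [Complex.sub_re, Complex.add_re, Complex.ofReal_re, Complex.mul_re, Complex.I_re,
      Complex.ofReal_im, Complex.I_im, Complex.sub_im, Complex.add_im, Complex.mul_im,
      Complex.one_re, Complex.one_im]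
    nlinarith
  rw [e]
  nlinarith

lemma D2_continuous {N : ℕ} {Ψ : Config N → ℂ} (h : Admissible N Ψ) (α : ℝ) (j k : Fin N)
    {γ : ℝ → Config N} {v v' : ℝ → Plane} (hγ : Continuous γ) (hv : Continuous v)
    (hv' : Continuous v') : Continuous (fun t => D2 N α j k Ψ (γ t) (v t) (v' t)) := by
  unfold D2
  have h1 := (DOp_fst_continuous h α j).comp hγ
  have h2 := (DOp_snd_continuous h α j).comp hγ
  have h3 := (DOp_fst_continuous h α k).comp hγ
  have h4 := (DOp_snd_continuous h α k).comp hγ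
  have c1 : Continuous (fun t => (((v t).1 : ℝ) : ℂ)) := Complex.continuous_ofReal.comp hv.fst
  have c2 : Continuous (fun t => (((v t).2 : ℝ) : ℂ)) := Complex.continuous_ofReal.comp hv.snd
  have c3 : Continuous (fun t => (((v' t).1 : ℝ) : ℂ)) := Complex.continuous_ofReal.comp hv'.fst
  have c4 : Continuous (fun t => (((v' t).2 : ℝ) : ℂ)) := Complex.continuous_ofReal.comp hv'.snd
  exact (((c1.mul h1).add (c2.mul h2)).add (c3.mul h3)).add (c4.mul h4)

lemma cs_abs {ψ ψ' : ℝ → ℂ} {b : ℝ → ℝ} {ρ : ℝ} (hr : 0 < ρ)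
    (hψd : ∀ t, HasDerivAt ψ (ψ' t) t) (hc : Continuous ψ')
    (hb : ∀ t, ‖ψ' t‖ ^ 2 ≤ ρ / 2 * b t) :
    ENNReal.ofReal (‖ψ π - ψ 0‖ ^ 2 / 2 / ρ) ≤
      ∫⁻ t in Set.Ioc (0 : ℝ) π, ENNReal.ofReal (π / 4 * b t) := by
  obtain ⟨e, he⟩ : ∃ e, e = ψ π - ψ 0 := ⟨_, rfl⟩
  have hp := Real.pi_pos
  have key := ftc_lintegral_le (p := 0) (q := π)
    (F := fun t => (inner ℝ e (ψ t - ψ 0) - t * (‖e‖ ^ 2 / (2 * π))) / ρ)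
    (F' := fun t => (inner ℝ e (ψ' t) - ‖e‖ ^ 2 / (2 * π)) / ρ)
    (b := fun t => π / 4 * b t)
    Real.pi_pos.le ?_ ?_ ?_
  · refine le_trans ?_ (key.trans (by simp))
    apply ENNReal.ofReal_le_ofReal
    rw [← he, real_inner_self_eq_norm_sq]
    have e5 : ‖e‖ ^ 2 - π * (‖e‖ ^ 2 / (2 * π)) = ‖e‖ ^ 2 / 2 := by field_simp; ring
    rw [e5]
  · intro t _
    have a1 : HasDerivAt (fun t => inner ℝ e (ψ t - ψ 0)) (inner ℝ e (ψ' t)) t := by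
      have := (hasDerivAt_const t e).inner ℝ ((hψd t).sub_const (ψ 0))
      simpa using this
    have a2 : HasDerivAt (fun t : ℝ => t * (‖e‖ ^ 2 / (2 * π))) (‖e‖ ^ 2 / (2 * π)) t := by
      simpa using (hasDerivAt_id t).mul_const (‖e‖ ^ 2 / (2 * π))
    exact (a1.sub a2).div_const _
  · apply Continuous.continuousOn
    exact (((continuous_const.inner hc).sub continuous_const).div_const _)
  · intro t _
    rw [div_le_iff₀ hr]
    have b1 : inner ℝ e (ψ' t) ≤ ‖e‖ * ‖ψ' t‖ := real_inner_le_norm _ _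
    have b2 := hb t
    have b3 : ‖e‖ * ‖ψ' t‖ ≤ ‖e‖ ^ 2 / (2 * π) + π / 2 * ‖ψ' t‖ ^ 2 := by
      have : ‖e‖ ^ 2 / (2 * π) + π / 2 * ‖ψ' t‖ ^ 2 - ‖e‖ * ‖ψ' t‖ = (‖e‖ - π * ‖ψ' t‖) ^ 2 / (2 * π) := by
        field_simp; ring
      have : 0 ≤ (‖e‖ - π * ‖ψ' t‖) ^ 2 / (2 * π) := by positivity
      linarith
    have b4 : π / 2 * ‖ψ' t‖ ^ 2 ≤ π / 2 * (ρ / 2 * b t) := by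
      gcongr
    linarith

/-- Covariant derivative along the rotation. -/
def ddrot {N : ℕ} (α : ℝ) (j k : Fin N) (Ψ : Config N → ℂ) (x : Config N) (θ : ℝ) : ℂ :=
  D2 N α j k Ψ (urot j k θ x) (rotv θ (x j - x k)) (-rotv θ (x j - x k))

/-- The gauge factor. -/
def urphase {N : ℕ} (α : ℝ) (j k : Fin N) (x : Config N) (θ : ℝ) : ℂ :=
  Complex.exp ((α * phaseB j k x θ : ℝ) * Complex.I)

lemma urphase_norm {N : ℕ} (α : ℝ) (j k : Fin N) (x : Config N) (θ : ℝ) :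
    ‖urphase α j k x θ‖ = 1 := Complex.norm_exp_ofReal_mul_I _

lemma ddrot_norm {N : ℕ} (α : ℝ) (j k : Fin N) (Ψ : Config N → ℂ) (x : Config N) (t : ℝ) :
    ‖ddrot α j k Ψ x t‖ ^ 2 ≤
      rsq j k x / 2 * (DSq N α j Ψ (urot j k t x) + DSq N α k Ψ (urot j k t x)) := by
  refine (D2_norm_sq_le Ψ α j k _ _ _).trans (le_of_eq ?_)
  congr 1
  simp only [rotv, rsq]
  have hsc := Real.sin_sq_add_cos_sq t
  simp
  linear_combination (((x j).1 - (x k).1) ^ 2 + ((x j).2 - (x k).2) ^ 2) / 2 * hsc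

lemma ddrot_continuous {N : ℕ} {Ψ : Config N → ℂ} (h : Admissible N Ψ) (α : ℝ) (j k : Fin N)
    (x : Config N) : Continuous (ddrot α j k Ψ x) := by
  have hyc : Continuous (fun θ : ℝ => urot j k θ x) :=
    continuous_iff_continuousAt.2 fun θ => (urot_hasDerivAt j k x θ).continuousAt
  have hvc : Continuous (fun θ => rotv θ (x j - x k)) := by
    unfold rotv; fun_prop
  have hvc' : Continuous (fun θ => -rotv θ (x j - x k)) := hvc.neg
  exact D2_continuous h α j k hyc hvc hvc'

lemma urphase_hasDerivAt {N : ℕ} (α : ℝ) {j k : Fin N} (hjk : j ≠ k) (x : Config N)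
    (hr : 0 < rsq j k x)
    (hfar : ∀ l, l ≠ j → l ≠ k → rsq j k x / 4 < ‖crel j k x l‖ ^ 2) (θ : ℝ) :
    HasDerivAt (urphase α j k x) (urphase α j k x θ * (((α * potForm N j k (urot j k θ x)
      (rotv θ (x j - x k)) (-rotv θ (x j - x k)) : ℝ) : ℂ) * Complex.I)) θ := by
  have h1 := phaseB_hasDerivAt x hfar θ
  rw [← potForm_urot hjk x hr hfar θ] at h1
  have h2 := (h1.const_mul α).ofReal_comp
  exact (h2.mul_const Complex.I).cexp

lemma psi_hasDerivAt {N : ℕ} {Ψ : Config N → ℂ} (h : Admissible N Ψ) (α : ℝ) {j k : Fin N}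
    (hjk : j ≠ k) (x : Config N) (hr : 0 < rsq j k x)
    (hfar : ∀ l, l ≠ j → l ≠ k → rsq j k x / 4 < ‖crel j k x l‖ ^ 2) (θ : ℝ) :
    HasDerivAt (fun θ => urphase α j k x θ * Ψ (urot j k θ x))
      (urphase α j k x θ * (Complex.I * ddrot α j k Ψ x θ)) θ := by
  have hΨd : HasDerivAt (fun θ => Ψ (urot j k θ x)) (fderiv ℝ Ψ (urot j k θ x)
      (Pi.single j (rotv θ (x j - x k)) + Pi.single k (-rotv θ (x j - x k)))) θ :=
    (h.differentiable (urot j k θ x)).hasFDerivAt.comp_hasDerivAt θ (urot_hasDerivAt j k x θ)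
  refine ((urphase_hasDerivAt α hjk x hr hfar θ).mul hΨd).congr_deriv ?_
  rw [fderiv_dir Ψ α, ddrot]
  ring

lemma psi_gap {N : ℕ} {Ψ : Config N → ℂ} (h : Admissible N Ψ) {α : ℝ} (h0 : 0 ≤ α) (h1 : α ≤ 1)
    {j k : Fin N} (hjk : j ≠ k) (x : Config N) :
    4 * α ^ 2 * ‖Ψ x‖ ^ 2 ≤
      ‖urphase α j k x π * Ψ (urot j k π x) - urphase α j k x 0 * Ψ (urot j k 0 x)‖ ^ 2 := by
  have e2 : urphase α j k x π = urphase α j k x 0 * Complex.exp ((α * π : ℝ) * Complex.I) := by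
    unfold urphase
    rw [← Complex.exp_add, phaseB_pi]
    congr 1
    push_cast; ring
  rw [urot_pi hjk, h.symm, urot_zero, e2]
  have e1 : urphase α j k x 0 * Complex.exp ((α * π : ℝ) * Complex.I) * Ψ x - urphase α j k x 0 * Ψ x
      = urphase α j k x 0 * (Complex.exp ((α * π : ℝ) * Complex.I) - 1) * Ψ x := by ring
  rw [e1, norm_mul, norm_mul, urphase_norm, one_mul, mul_pow]
  exact mul_le_mul_of_nonneg_right (phase_gap h0 h1) (sq_nonneg _)

lemma angular_point {N : ℕ} {Ψ : Config N → ℂ} (h : Admissible N Ψ) {α : ℝ} (h0 : 0 ≤ α) (h1 : α ≤ 1)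
    {j k : Fin N} (hjk : j ≠ k) (x : Config N)
    (hfar : ∀ l, l ≠ j → l ≠ k → rsq j k x / 4 < ‖crel j k x l‖ ^ 2) :
    ENNReal.ofReal (2 * α ^ 2 * (‖Ψ x‖ ^ 2 / rsq j k x)) ≤ ∫⁻ t in Set.Ioc (0 : ℝ) π,
      ENNReal.ofReal (π / 4 * (DSq N α j Ψ (urot j k t x) + DSq N α k Ψ (urot j k t x))) := by
  rcases (rsq_nonneg j k x).eq_or_lt with hr | hr
  · rw [← hr]; simp
  have hd := psi_hasDerivAt h α hjk x hr hfar
  have huc : Continuous (urphase α j k x) :=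
    continuous_iff_continuousAt.2 fun θ => (urphase_hasDerivAt α hjk x hr hfar θ).continuousAt
  have key := cs_abs hr hd (huc.mul ((ddrot_continuous h α j k x).const_mul _))
    (b := fun t => DSq N α j Ψ (urot j k t x) + DSq N α k Ψ (urot j k t x)) (fun t => by
      rw [norm_mul, norm_mul, urphase_norm, Complex.norm_I, one_mul, one_mul]
      exact ddrot_norm α j k Ψ x t)
  refine le_trans ?_ key
  apply ENNReal.ofReal_le_ofReal
  have hg := psi_gap h h0 h1 hjk x
  rw [mul_div_assoc']
  apply div_le_div_of_nonneg_right _ hr.le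
  linarith

lemma angular {N : ℕ} {Ψ : Config N → ℂ} (h : Admissible N Ψ) {α : ℝ} (h0 : 0 ≤ α) (h1 : α ≤ 1)
    {j k : Fin N} (hjk : j ≠ k) (W : Set (Config N)) (hW : MeasurableSet W)
    (hfar : ∀ x ∈ W, ∀ l, l ≠ j → l ≠ k → rsq j k x / 4 < ‖crel j k x l‖ ^ 2)
    (hWr : ∀ x ∈ W, ∀ θ, urot j k θ x ∈ W) :
    ∫⁻ x in W, ENNReal.ofReal (α ^ 2 * (‖Ψ x‖ ^ 2 / rsq j k x))
      ≤ 2 * ∫⁻ x in W, ENNReal.ofReal (DSq N α j Ψ x + DSq N α k Ψ x) := by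
  set G : Config N → ENNReal := fun x => ENNReal.ofReal (DSq N α j Ψ x + DSq N α k Ψ x) with hG
  have hDc : Continuous (fun x => DSq N α j Ψ x + DSq N α k Ψ x) :=
    (DSq_continuous h α j).add (DSq_continuous h α k)
  have hGm : Measurable G := ENNReal.measurable_ofReal.comp hDc.measurable
  have hm : Measurable (fun z : Config N × ℝ => ENNReal.ofReal (π / 4 *
      (DSq N α j Ψ (urot j k z.2 z.1) + DSq N α k Ψ (urot j k z.2 z.1)))) :=
    ENNReal.measurable_ofReal.comp ((hDc.comp (urot_continuous j k)).measurable.const_mul _)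
  have step : ∫⁻ x in W, ENNReal.ofReal (2 * α ^ 2 * (‖Ψ x‖ ^ 2 / rsq j k x))
      ≤ ENNReal.ofReal (π ^ 2 / 4) * ∫⁻ x in W, G x := by
    calc ∫⁻ x in W, ENNReal.ofReal (2 * α ^ 2 * (‖Ψ x‖ ^ 2 / rsq j k x))
        ≤ ∫⁻ x in W, ∫⁻ t in Set.Ioc (0 : ℝ) π, ENNReal.ofReal (π / 4 *
      (DSq N α j Ψ (urot j k t x) + DSq N α k Ψ (urot j k t x))) :=
          setLIntegral_mono_ae' hW (Filter.Eventually.of_forall fun x hx =>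
            angular_point h h0 h1 hjk x (hfar x hx))
      _ = ∫⁻ t in Set.Ioc (0 : ℝ) π, ∫⁻ x in W, ENNReal.ofReal (π / 4 *
      (DSq N α j Ψ (urot j k t x) + DSq N α k Ψ (urot j k t x))) :=
          lintegral_lintegral_swap hm.aemeasurable
      _ ≤ ∫⁻ t in Set.Ioc (0 : ℝ) π, ENNReal.ofReal (π / 4) * ∫⁻ x in W, G x := by
          refine lintegral_mono fun t => ?_
          have hp : 0 ≤ π / 4 := by positivity
          simp only [ENNReal.ofReal_mul hp]
          rw [lintegral_const_mul' _ _ ENNReal.ofReal_ne_top]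
          refine mul_le_mul' le_rfl ?_
          rw [← lintegral_indicator hW, ← lintegral_indicator hW,
            ← (urot_measurePreserving hjk t).lintegral_comp (hGm.indicator hW)]
          refine lintegral_mono fun x => ?_
          by_cases hx : x ∈ W
          · rw [Set.indicator_of_mem hx, Set.indicator_of_mem (hWr x hx t)]
          · rw [Set.indicator_of_notMem hx]; exact zero_le
      _ = ENNReal.ofReal (π ^ 2 / 4) * ∫⁻ x in W, G x := by
          rw [lintegral_const, Measure.restrict_apply MeasurableSet.univ, Set.univ_inter,
            Real.volume_Ioc, sub_zero, mul_comm, ← mul_assoc, ← ENNReal.ofReal_mul Real.pi_pos.le]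
          congr 2; ring
  have e1 : ∀ x, ENNReal.ofReal (2 * α ^ 2 * (‖Ψ x‖ ^ 2 / rsq j k x))
      = 2 * ENNReal.ofReal (α ^ 2 * (‖Ψ x‖ ^ 2 / rsq j k x)) := by
    intro x
    rw [mul_assoc, ENNReal.ofReal_mul (by norm_num)]; simp
  simp only [e1] at step
  rw [lintegral_const_mul' _ _ (by norm_num)] at step
  have hpi : ENNReal.ofReal (π ^ 2 / 4) ≤ 4 := by
    have : π ^ 2 / 4 ≤ 4 := by nlinarith [Real.pi_le_four, Real.pi_pos]
    calc ENNReal.ofReal (π ^ 2 / 4) ≤ ENNReal.ofReal 4 := ENNReal.ofReal_le_ofReal this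
      _ = 4 := by simp
  have h2 : 2 * ∫⁻ x in W, ENNReal.ofReal (α ^ 2 * (‖Ψ x‖ ^ 2 / rsq j k x))
      ≤ 2 * (2 * ∫⁻ x in W, G x) := by
    refine step.trans ((mul_le_mul' hpi le_rfl).trans (le_of_eq ?_))
    rw [← mul_assoc]; norm_num
  exact (ENNReal.mul_le_mul_iff_right (by norm_num) (by norm_num)).1 h2


/-- Corner of the quadrant `q` of the box with corner `a` and side `s`. -/
def qcor (a : Plane) (s : ℝ) (q : Bool × Bool) : Plane :=
  (a.1 + if q.1 then s / 2 else 0, a.2 + if q.2 then s / 2 else 0)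

/-- Index of the cell at the centre of the quadrant. -/
def qidx (q : Bool × Bool) : Fin 16 × Fin 16 := (if q.1 then 12 else 4, if q.2 then 12 else 4)

lemma cell_qidx (a : Plane) (s : ℝ) (q : Bool × Bool) :
    cell a s (qidx q) = box ((qcor a s q).1 + s / 4, (qcor a s q).2 + s / 4) (s / 16) := by
  unfold cell qidx qcor
  congr 1
  obtain ⟨q1, q2⟩ := q
  have e4 : (((4 : Fin 16) : ℕ) : ℝ) = 4 := by norm_num
  have e12 : (((12 : Fin 16) : ℕ) : ℝ) = 12 := by norm_num
  ext <;> cases q1 <;> cases q2 <;> simp [e4, e12] <;> ring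

lemma qbox_subset (a : Plane) {s : ℝ} (hs : 0 < s) (q : Bool × Bool) :
    box (qcor a s q) (s / 2) ⊆ box a s := by
  intro p hp
  rw [mem_box] at *
  unfold qcor at hp
  obtain ⟨q1, q2⟩ := q
  cases q1 <;> cases q2 <;> simp at hp ⊢ <;> refine ⟨⟨?_, ?_⟩, ?_, ?_⟩ <;>
    linarith [hp.1.1, hp.1.2, hp.2.1, hp.2.2]

/-- The region for the angular estimate. -/
def angReg {N : ℕ} (j k : Fin N) (O : Fin N → Set Plane) (m : Plane) (s : ℝ) : Set (Config N) :=
  {x | (|((x j).1 + (x k).1) / 2 - m.1| < s / 8 ∧ |((x j).2 + (x k).2) / 2 - m.2| < s / 8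
    ∧ rsq j k x < (s / 8) ^ 2) ∧ ∀ l, l ≠ j → l ≠ k → x l ∈ O l}

/-- The region for the radial estimate. -/
def radReg {N : ℕ} (j k : Fin N) (O : Fin N → Set Plane) (T : Set Plane) (s : ℝ) : Set (Config N) :=
  {x | (x k ∈ T ∧ rsq j k x < (s / 8) ^ 2) ∧ ∀ l, l ≠ j → l ≠ k → x l ∈ O l}

lemma measurableSet_oth {N : ℕ} (j k : Fin N) (O : Fin N → Set Plane) (hO : ∀ l, MeasurableSet (O l)) :
    MeasurableSet {x : Config N | ∀ l, l ≠ j → l ≠ k → x l ∈ O l} := by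
  have := measurableSet_reg j k O Set.univ Set.univ hO MeasurableSet.univ MeasurableSet.univ
  simpa [reg] using this

lemma measurableSet_angReg {N : ℕ} (j k : Fin N) (O : Fin N → Set Plane)
    (hO : ∀ l, MeasurableSet (O l)) (m : Plane) (s : ℝ) : MeasurableSet (angReg j k O m s) := by
  refine MeasurableSet.inter ?_ (measurableSet_oth j k O hO)
  have c1 : Continuous (fun x : Config N => |((x j).1 + (x k).1) / 2 - m.1|) := by fun_prop
  have c2 : Continuous (fun x : Config N => |((x j).2 + (x k).2) / 2 - m.2|) := by fun_prop
  exact (measurableSet_lt c1.measurable measurable_const).inter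
    ((measurableSet_lt c2.measurable measurable_const).inter
      (measurableSet_lt (rsq_continuous j k).measurable measurable_const))

lemma measurableSet_radReg {N : ℕ} (j k : Fin N) (O : Fin N → Set Plane)
    (hO : ∀ l, MeasurableSet (O l)) (T : Set Plane) (hT : MeasurableSet T) (s : ℝ) :
    MeasurableSet (radReg j k O T s) := by
  refine MeasurableSet.inter ?_ (measurableSet_oth j k O hO)
  exact (measurable_pi_apply k hT).inter
    (measurableSet_lt (rsq_continuous j k).measurable measurable_const)

lemma abs_lt_of_rsq {N : ℕ} {j k : Fin N} {x : Config N} {s : ℝ} (hs : 0 < s)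
    (h : rsq j k x < (s / 8) ^ 2) : |(x j).1 - (x k).1| < s / 8 ∧ |(x j).2 - (x k).2| < s / 8 := by
  unfold rsq at h
  constructor
  · apply abs_lt_of_sq_lt_sq _ (by positivity)
    nlinarith [sq_nonneg ((x j).2 - (x k).2)]
  · apply abs_lt_of_sq_lt_sq _ (by positivity)
    nlinarith [sq_nonneg ((x j).1 - (x k).1)]

lemma reg_sub_rad {N : ℕ} (j k : Fin N) (O : Fin N → Set Plane) (m : Plane) {s : ℝ} (hs : 0 < s) :
    reg j k O (box m (s / 16)) (box m (s / 16)) ⊆ radReg j k O (box m (s / 16)) s := by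
  rintro x ⟨h1, h2, h3⟩
  refine ⟨⟨h2, ?_⟩, h3⟩
  rw [mem_box] at h1 h2
  unfold rsq
  have e1 : ((x j).1 - (x k).1) ^ 2 ≤ (s / 16) ^ 2 := by
    apply sq_le_sq' <;> linarith [h1.1.1, h1.1.2, h2.1.1, h2.1.2]
  have e2 : ((x j).2 - (x k).2) ^ 2 ≤ (s / 16) ^ 2 := by
    apply sq_le_sq' <;> linarith [h1.2.1, h1.2.2, h2.2.1, h2.2.2]
  nlinarith

lemma rad_sub_ang {N : ℕ} (j k : Fin N) (O : Fin N → Set Plane) (m : Plane) {s : ℝ} (hs : 0 < s) :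
    radReg j k O (box m (s / 16)) s ⊆ angReg j k O m s := by
  rintro x ⟨⟨h2, hr⟩, h3⟩
  obtain ⟨r1, r2⟩ := abs_lt_of_rsq hs hr
  rw [mem_box] at h2
  rw [abs_lt] at r1 r2
  refine ⟨⟨?_, ?_, hr⟩, h3⟩
  · rw [abs_lt]; constructor <;> linarith [h2.1.1, h2.1.2]
  · rw [abs_lt]; constructor <;> linarith [h2.2.1, h2.2.2]

lemma ang_sub_reg {N : ℕ} (j k : Fin N) (O : Fin N → Set Plane) (a' : Plane) {s : ℝ} (hs : 0 < s) :
    angReg j k O (a'.1 + s / 4, a'.2 + s / 4) s ⊆ reg j k O (box a' (s / 2)) (box a' (s / 2)) := by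
  rintro x ⟨⟨h1, h2, hr⟩, h3⟩
  obtain ⟨r1, r2⟩ := abs_lt_of_rsq hs hr
  rw [abs_lt] at r1 r2 h1 h2
  simp only at h1 h2
  refine ⟨?_, ?_, h3⟩ <;> rw [mem_box] <;> refine ⟨⟨?_, ?_⟩, ?_, ?_⟩ <;> linarith

lemma ang_urot {N : ℕ} {j k : Fin N} (hjk : j ≠ k) (O : Fin N → Set Plane) (m : Plane) (s : ℝ)
    (x : Config N) (hx : x ∈ angReg j k O m s) (θ : ℝ) : urot j k θ x ∈ angReg j k O m s := by
  obtain ⟨⟨h1, h2, hr⟩, h3⟩ := hx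
  refine ⟨⟨?_, ?_, ?_⟩, ?_⟩
  · rw [urot_j hjk, urot_k hjk]; simpa using h1
  · rw [urot_j hjk, urot_k hjk]; simpa using h2
  · rwa [rsq_urot hjk]
  · intro l hj hk; rw [urot_l hj hk]; exact h3 l hj hk

lemma rad_dil {N : ℕ} {j k : Fin N} (hjk : j ≠ k) (O : Fin N → Set Plane) (T : Set Plane) (s : ℝ)
    (x : Config N) (hx : x ∈ radReg j k O T s) (t : ℝ) (ht : t ∈ Set.Ioc (0 : ℝ) 1) :
    dil j k t x ∈ radReg j k O T s := by
  obtain ⟨⟨h1, hr⟩, h3⟩ := hx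
  refine ⟨⟨?_, ?_⟩, ?_⟩
  · rwa [dil_apply_l k hjk.symm]
  · rw [rsq_dil hjk]
    have h0 := rsq_nonneg j k x
    have : t ^ 2 ≤ 1 := by nlinarith [ht.1, ht.2]
    nlinarith
  · intro l hj hk; rw [dil_apply_l k hj]; exact h3 l hj hk

lemma ang_far {N : ℕ} {j k : Fin N} (O : Fin N → Set Plane) (a' : Plane) {s : ℝ}
    (hs : 0 < s) (hO : ∀ l, l ≠ j → l ≠ k → Disjoint (O l) (box a' (s / 2)))
    (x : Config N) (hx : x ∈ angReg j k O (a'.1 + s / 4, a'.2 + s / 4) s) (l : Fin N) (hj : l ≠ j)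
    (hk : l ≠ k) : rsq j k x / 4 < ‖crel j k x l‖ ^ 2 := by
  obtain ⟨⟨h1, h2, hr⟩, h3⟩ := hx
  simp only [abs_lt] at h1 h2
  have hn : x l ∉ box a' (s / 2) := Set.disjoint_left.1 (hO l hj hk) (h3 l hj hk)
  have e : crel j k x l = toC ((((x j).1 + (x k).1) / 2 - (x l).1, ((x j).2 + (x k).2) / 2 - (x l).2)) := by
    simp [crel, toC]; ring
  rw [e, toC_normSq]
  simp only
  by_contra hcon
  push Not at hcon
  apply hn
  have q1 : |((x j).1 + (x k).1) / 2 - (x l).1| < s / 16 := by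
    apply abs_lt_of_sq_lt_sq _ (by positivity)
    nlinarith [sq_nonneg (((x j).2 + (x k).2) / 2 - (x l).2)]
  have q2 : |((x j).2 + (x k).2) / 2 - (x l).2| < s / 16 := by
    apply abs_lt_of_sq_lt_sq _ (by positivity)
    nlinarith [sq_nonneg (((x j).1 + (x k).1) / 2 - (x l).1)]
  rw [abs_lt] at q1 q2
  rw [mem_box]
  refine ⟨⟨?_, ?_⟩, ?_, ?_⟩ <;> linarith

lemma two_particle {N : ℕ} {Ψ : Config N → ℂ} (h : Admissible N Ψ) {α : ℝ} (h0 : 0 < α) (h1 : α ≤ 1)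
    {j k : Fin N} (hjk : j ≠ k) (O : Fin N → Set Plane) (hO : ∀ l, MeasurableSet (O l))
    (a : Plane) {s : ℝ} (hs : 0 < s) (q : Bool × Bool)
    (hd : ∀ l, l ≠ j → l ≠ k → Disjoint (O l) (box (qcor a s q) (s / 2))) :
    ENNReal.ofReal (α / (1000000 * s ^ 2)) *
      ∫⁻ x in reg j k O (box a s) (box a s), ENNReal.ofReal (‖Ψ x‖ ^ 2) ≤
      ∫⁻ x in reg j k O (box a s) (box a s), ENNReal.ofReal (DSq N α j Ψ x + DSq N α k Ψ x) := by
  have hP := poinc_box h α hjk O hO a hs (qidx q)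
  rw [cell_qidx] at hP
  set P := reg j k O (box a s) (box a s) with hPdef
  set a' := qcor a s q with ha'
  set m : Plane := (a'.1 + s / 4, a'.2 + s / 4) with hm
  set I := ∫⁻ x in P, ENNReal.ofReal (DSq N α j Ψ x + DSq N α k Ψ x) with hI
  have hsub : angReg j k O m s ⊆ P := by
    refine (ang_sub_reg j k O a' hs).trans ?_
    rintro x ⟨b1, b2, b3⟩
    exact ⟨qbox_subset a hs q b1, qbox_subset a hs q b2, b3⟩
  have hsub2 := rad_sub_ang j k O m hs
  have hang : ∫⁻ x in radReg j k O (box m (s / 16)) s, ENNReal.ofReal (α ^ 2 * (‖Ψ x‖ ^ 2 / rsq j k x))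
      ≤ 2 * I := by
    refine (lintegral_mono_set hsub2).trans ?_
    refine (angular h h0.le h1 hjk _ (measurableSet_angReg j k O hO m s)
      (fun x hx l hj hk => ang_far O a' hs hd x hx l hj hk)
      (fun x hx θ => ang_urot hjk O m s x hx θ)).trans ?_
    exact mul_le_mul' le_rfl (lintegral_mono_set hsub)
  have hrad := radial h h0 hjk (radReg j k O (box m (s / 16)) s)
    (measurableSet_radReg j k O hO _ (measurableSet_box _ _) s) (ρ := s / 8) (by positivity)
    (fun x hx => hx.1.2) (fun x hx t ht => rad_dil hjk O _ s x hx t ht)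
  have hdec : ∫⁻ x in radReg j k O (box m (s / 16)) s, ENNReal.ofReal (hdens α j k Ψ x)
      ≤ ENNReal.ofReal (1 / α) * (3 * I) := by
    have e1 : ∀ x, ENNReal.ofReal (hdens α j k Ψ x) ≤ ENNReal.ofReal (1 / α) *
        (ENNReal.ofReal (DSq N α j Ψ x + DSq N α k Ψ x)
          + ENNReal.ofReal (α ^ 2 * (‖Ψ x‖ ^ 2 / rsq j k x))) := by
      intro x
      have d1 := DSq_nonneg Ψ α j x
      have d2 := DSq_nonneg Ψ α k x
      have d3 := rsq_nonneg j k x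
      rw [← ENNReal.ofReal_add (by positivity) (by positivity), ← ENNReal.ofReal_mul (by positivity)]
      apply ENNReal.ofReal_le_ofReal
      unfold hdens
      have : 1 / α * (DSq N α j Ψ x + DSq N α k Ψ x + α ^ 2 * (‖Ψ x‖ ^ 2 / rsq j k x))
          = DSq N α j Ψ x / α + α * ‖Ψ x‖ ^ 2 / rsq j k x + DSq N α k Ψ x / α := by
        field_simp; ring
      rw [this]
      have : 0 ≤ DSq N α k Ψ x / α := by positivity
      linarith
    refine (lintegral_mono e1).trans ?_
    rw [lintegral_const_mul' _ _ ENNReal.ofReal_ne_top]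
    refine mul_le_mul' le_rfl ?_
    have hDc : Continuous (fun x => DSq N α j Ψ x + DSq N α k Ψ x) :=
      (DSq_continuous h α j).add (DSq_continuous h α k)
    have hDm : Measurable (fun x => ENNReal.ofReal (DSq N α j Ψ x + DSq N α k Ψ x)) :=
      ENNReal.measurable_ofReal.comp hDc.measurable
    rw [lintegral_add_left hDm]
    have e3 : (3 : ENNReal) * I = I + 2 * I := by
      rw [← one_add_mul]; norm_num
    rw [e3]
    exact add_le_add (lintegral_mono_set (hsub2.trans hsub)) hang
  have hTT : ∫⁻ x in reg j k O (box m (s / 16)) (box m (s / 16)), ENNReal.ofReal (‖Ψ x‖ ^ 2)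
      ≤ ENNReal.ofReal (3 * s ^ 2 / (128 * α)) * I := by
    refine (lintegral_mono_set (reg_sub_rad j k O m hs)).trans (hrad.trans ?_)
    refine (mul_le_mul' le_rfl hdec).trans (le_of_eq ?_)
    rw [← mul_assoc, ← mul_assoc, ← ENNReal.ofReal_mul (by positivity)]
    have : (3 : ENNReal) = ENNReal.ofReal 3 := by simp
    rw [this, ← ENNReal.ofReal_mul (by positivity)]
    congr 2
    field_simp
    norm_num
  have hfin : ∫⁻ x in P, ENNReal.ofReal (‖Ψ x‖ ^ 2) ≤ ENNReal.ofReal (1000000 * s ^ 2 / α) * I := by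
    refine hP.trans ?_
    have h65 : (65536 : ENNReal) = ENNReal.ofReal 65536 := by simp
    calc _ ≤ 65536 * (ENNReal.ofReal (Real.exp 1) *
          (ENNReal.ofReal (3 * s ^ 2 / (128 * α)) * I + ENNReal.ofReal (4 * s ^ 2) * I)) :=
          mul_le_mul' le_rfl (mul_le_mul' le_rfl (add_le_add hTT le_rfl))
      _ = ENNReal.ofReal (65536 * (Real.exp 1 * (3 * s ^ 2 / (128 * α) + 4 * s ^ 2))) * I := by
          rw [← add_mul, ← ENNReal.ofReal_add (by positivity) (by positivity), h65, ← mul_assoc,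
            ← mul_assoc, mul_assoc (ENNReal.ofReal 65536), ← ENNReal.ofReal_mul (by positivity),
            ← ENNReal.ofReal_mul (by positivity)]
      _ ≤ _ := by
          refine mul_le_mul' (ENNReal.ofReal_le_ofReal ?_) le_rfl
          have he : Real.exp 1 ≤ 3 := by linarith [Real.exp_one_lt_d9]
          have hs2 : s ^ 2 ≤ s ^ 2 / α := by
            rw [le_div_iff₀ h0]; nlinarith [sq_nonneg s]
          have e1 : 3 * s ^ 2 / (128 * α) = 3 / 128 * (s ^ 2 / α) := by field_simp
          have e2 : 1000000 * s ^ 2 / α = 1000000 * (s ^ 2 / α) := by ring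
          rw [e1, e2]
          have hp : 0 ≤ s ^ 2 / α := by positivity
          have : Real.exp 1 * (3 / 128 * (s ^ 2 / α) + 4 * s ^ 2) ≤ 3 * (5 * (s ^ 2 / α)) := by
            apply mul_le_mul he _ (by positivity) (by norm_num)
            linarith
          linarith
  calc _ ≤ ENNReal.ofReal (α / (1000000 * s ^ 2)) * (ENNReal.ofReal (1000000 * s ^ 2 / α) * I) :=
        mul_le_mul' le_rfl hfin
    _ = I := by
        rw [← mul_assoc, ← ENNReal.ofReal_mul (by positivity)]
        have : α / (1000000 * s ^ 2) * (1000000 * s ^ 2 / α) = 1 := by field_simp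
        rw [this]; simp


lemma lint_partition {X ι : Type*} [MeasurableSpace X] {μ : Measure X} [Fintype ι] (S : Set X)
    (A : ι → Set X) (hA : ∀ i, MeasurableSet (A i)) (hdisj : Pairwise (Function.onFun Disjoint A))
    (hU : ⋃ i, A i = S) (f : X → ENNReal) :
    ∫⁻ x in S, f x ∂μ = ∑ i, ∫⁻ x in A i, f x ∂μ := by
  rw [← hU, lintegral_iUnion hA hdisj, tsum_fintype]

lemma pi_partition {N : ℕ} (B : Fin N → Set Plane) (hB : ∀ l, MeasurableSet (B l))
    (c : Fin N → Plane → Bool × Bool) (hc : ∀ l q, MeasurableSet (c l ⁻¹' {q}))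
    (f : Config N → ENNReal) :
    ∫⁻ x in Set.univ.pi B, f x = ∑ σ : Fin N → Bool × Bool,
      ∫⁻ x in Set.univ.pi (fun l => B l ∩ c l ⁻¹' {σ l}), f x := by
  apply lint_partition
  · intro σ
    exact MeasurableSet.univ_pi fun l => (hB l).inter (hc l _)
  · intro σ τ hστ
    rw [Function.onFun, Set.disjoint_left]
    intro x hx hx'
    apply hστ
    funext l
    have h1 := (hx l (Set.mem_univ l)).2
    have h2 := (hx' l (Set.mem_univ l)).2
    exact (h1 : c l (x l) = σ l).symm.trans h2
  · ext x
    simp only [Set.mem_iUnion]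
    constructor
    · rintro ⟨σ, hσ⟩ l hl
      exact (hσ l hl).1
    · intro hx
      exact ⟨fun l => c l (x l), fun l hl => ⟨hx l hl, rfl⟩⟩

open Classical in
/-- Quadrant of a point. -/
def quad (a : Plane) (s : ℝ) (p : Plane) : Bool × Bool :=
  (decide (a.1 + s / 2 ≤ p.1), decide (a.2 + s / 2 ≤ p.2))

lemma quad_eq_iff (a : Plane) (s : ℝ) (p : Plane) (q : Bool × Bool) : quad a s p = q ↔
    ((q.1 = true ↔ a.1 + s / 2 ≤ p.1) ∧ (q.2 = true ↔ a.2 + s / 2 ≤ p.2)) := by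
  obtain ⟨q1, q2⟩ := q
  cases q1 <;> cases q2 <;> simp [quad]

lemma measurableSet_quad (a : Plane) (s : ℝ) (q : Bool × Bool) :
    MeasurableSet (quad a s ⁻¹' {q}) := by
  have : quad a s ⁻¹' {q} = {p : Plane | ((q.1 = true ↔ a.1 + s / 2 ≤ p.1) ∧ (q.2 = true ↔ a.2 + s / 2 ≤ p.2))} := by
    ext p; exact quad_eq_iff a s p q
  rw [this]
  have m1 : MeasurableSet {p : Plane | a.1 + s / 2 ≤ p.1} := measurableSet_le measurable_const measurable_fst
  have m2 : MeasurableSet {p : Plane | a.2 + s / 2 ≤ p.2} := measurableSet_le measurable_const measurable_snd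
  obtain ⟨q1, q2⟩ := q
  cases q1 <;> cases q2 <;> simp only [reduceCtorEq, false_iff, true_iff]
  · exact m1.compl.inter m2.compl
  · exact m1.compl.inter m2
  · exact m1.inter m2.compl
  · exact m1.inter m2

lemma box_inter_quad (a : Plane) {s : ℝ} (hs : 0 < s) (q : Bool × Bool) :
    box a s ∩ quad a s ⁻¹' {q} = box (qcor a s q) (s / 2) := by
  ext p
  rw [Set.mem_inter_iff, Set.mem_preimage, Set.mem_singleton_iff, quad_eq_iff, mem_box, mem_box]
  obtain ⟨q1, q2⟩ := q
  cases q1 <;> cases q2 <;> simp [qcor] <;> constructor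
  all_goals first
    | (rintro ⟨⟨⟨h1, h2⟩, h3, h4⟩, h5, h6⟩; refine ⟨⟨?_, ?_⟩, ?_, ?_⟩ <;> linarith)
    | (rintro ⟨⟨h1, h2⟩, h3, h4⟩; refine ⟨⟨⟨?_, ?_⟩, ?_, ?_⟩, ?_, ?_⟩ <;> linarith)

lemma exists_quad_notMem (S : Finset (Bool × Bool)) (h : S.card ≤ 3) : ∃ q, q ∉ S := by
  by_contra hcon
  push Not at hcon
  have : S = Finset.univ := by ext q; simp [hcon q]
  rw [this] at h
  simp at h

/-- The lower bound function. -/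
def fN (n : ℕ) : ℝ := (n : ℝ) ^ 2 + 5 * n - 6

lemma small_case {N : ℕ} {Ψ : Config N → ℂ} (h : Admissible N Ψ) {α : ℝ} (h0 : 0 < α) (h1 : α ≤ 1)
    (a : Plane) {s : ℝ} (hs : 0 < s) (J : Finset (Fin N)) (B : Fin N → Set Plane)
    (hB : ∀ l, MeasurableSet (B l)) (hJ : ∀ l ∈ J, B l = box a s)
    (hJ' : ∀ l, l ∉ J → Disjoint (B l) (box a s)) (h2 : 2 ≤ J.card) (h5 : J.card ≤ 5) :
    ENNReal.ofReal (α / (44000000 * s ^ 2) * fN J.card) *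
      ∫⁻ x in Set.univ.pi B, ENNReal.ofReal (‖Ψ x‖ ^ 2) ≤
      ∑ j ∈ J, ∫⁻ x in Set.univ.pi B, ENNReal.ofReal (DSq N α j Ψ x) := by
  have hc : ENNReal.ofReal (α / (44000000 * s ^ 2) * fN J.card)
      ≤ ENNReal.ofReal (α / (1000000 * s ^ 2)) := by
    apply ENNReal.ofReal_le_ofReal
    have hf : fN J.card ≤ 44 := by
      have : (J.card : ℝ) ≤ 5 := by exact_mod_cast h5
      have : (0 : ℝ) ≤ J.card := by positivity
      unfold fN; nlinarith
    calc α / (44000000 * s ^ 2) * fN J.card ≤ α / (44000000 * s ^ 2) * 44 := by gcongr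
      _ = α / (1000000 * s ^ 2) := by field_simp; norm_num
  refine (mul_le_mul' hc le_rfl).trans ?_
  obtain ⟨j, hj, k, hk, hjk⟩ := Finset.one_lt_card.1 h2
  set c : Fin N → Plane → Bool × Bool :=
    fun l => if l = j ∨ l = k then fun _ => (false, false) else quad a s with hcdef
  have hcm : ∀ l q, MeasurableSet (c l ⁻¹' {q}) := by
    intro l q
    simp only [hcdef]
    split_ifs
    · exact measurable_const (measurableSet_singleton q)
    · exact measurableSet_quad a s q
  have hpair : ∫⁻ x in Set.univ.pi B, ENNReal.ofReal (DSq N α j Ψ x + DSq N α k Ψ x)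
      ≤ ∑ j ∈ J, ∫⁻ x in Set.univ.pi B, ENNReal.ofReal (DSq N α j Ψ x) := by
    have hm : Measurable (fun x => ENNReal.ofReal (DSq N α j Ψ x)) :=
      ENNReal.measurable_ofReal.comp (DSq_continuous h α j).measurable
    have e : ∀ x, ENNReal.ofReal (DSq N α j Ψ x + DSq N α k Ψ x)
        = ENNReal.ofReal (DSq N α j Ψ x) + ENNReal.ofReal (DSq N α k Ψ x) := fun x =>
      ENNReal.ofReal_add (DSq_nonneg Ψ α j x) (DSq_nonneg Ψ α k x)
    simp only [e]
    rw [lintegral_add_left hm]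
    rw [← Finset.sum_pair (f := fun i => ∫⁻ x in Set.univ.pi B, ENNReal.ofReal (DSq N α i Ψ x)) hjk]
    apply Finset.sum_le_sum_of_subset
    intro i hi
    rcases Finset.mem_insert.1 hi with rfl | hi
    · exact hj
    · rw [Finset.mem_singleton.1 hi]; exact hk
  refine le_trans ?_ hpair
  rw [pi_partition B hB c hcm, pi_partition B hB c hcm, Finset.mul_sum]
  refine Finset.sum_le_sum fun σ _ => ?_
  by_cases hσ : σ j = (false, false) ∧ σ k = (false, false)
  · set B' : Fin N → Set Plane := fun l => B l ∩ c l ⁻¹' {σ l} with hB'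
    have hreg : Set.univ.pi B' = reg j k B' (box a s) (box a s) := by
      have bj : B' j = box a s := by
        simp only [hB', hcdef]; rw [hJ j hj]; simp [hσ.1]
      have bk : B' k = box a s := by
        simp only [hB', hcdef]; rw [hJ k hk]; simp [hσ.2]
      ext x
      constructor
      · intro hx
        have q1 := hx j (Set.mem_univ _)
        have q2 := hx k (Set.mem_univ _)
        rw [bj] at q1; rw [bk] at q2
        exact ⟨q1, q2, fun l _ _ => hx l (Set.mem_univ _)⟩
      · rintro ⟨q1, q2, q3⟩ l _
        by_cases lj : l = j
        · subst lj; rw [bj]; exact q1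
        by_cases lk : l = k
        · subst lk; rw [bk]; exact q2
        exact q3 l lj lk
    obtain ⟨q, hq⟩ := exists_quad_notMem (((J.erase j).erase k).image σ) (by
      refine Finset.card_image_le.trans ?_
      rw [Finset.card_erase_of_mem (Finset.mem_erase.2 ⟨hjk.symm, hk⟩), Finset.card_erase_of_mem hj]
      omega)
    rw [hreg]
    refine two_particle h h0 h1 hjk B' (fun l => (hB l).inter (hcm l _)) a hs q ?_
    intro l lj lk
    by_cases hl : l ∈ J
    · have hlq : σ l ≠ q := fun he => hq (Finset.mem_image.2
        ⟨l, Finset.mem_erase.2 ⟨lk, Finset.mem_erase.2 ⟨lj, hl⟩⟩, he⟩)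
      rw [← box_inter_quad a hs q, Set.disjoint_left]
      rintro p ⟨_, hp⟩ ⟨_, hp'⟩
      simp only [hcdef, lj, lk, or_self, if_false] at hp
      exact hlq ((hp : quad a s p = σ l).symm.trans hp')
    · exact ((hJ' l hl).mono_left Set.inter_subset_left).mono_right (qbox_subset a hs q)
  · have hemp : Set.univ.pi (fun l => B l ∩ c l ⁻¹' {σ l}) = ∅ := by
      rw [Set.eq_empty_iff_forall_notMem]
      intro x hx
      apply hσ
      have q1 := (hx j (Set.mem_univ _)).2
      have q2 := (hx k (Set.mem_univ _)).2
      simp only [hcdef, true_or, or_true, if_true] at q1 q2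
      exact ⟨q1.symm, q2.symm⟩
    rw [hemp]; simp

lemma ofReal_sum_le_sum {ι : Type*} (S : Finset ι) (f : ι → ℝ) :
    ENNReal.ofReal (∑ i ∈ S, f i) ≤ ∑ i ∈ S, ENNReal.ofReal (f i) := by
  classical
  induction S using Finset.induction_on with
  | empty => simp
  | insert i S hi ih =>
    rw [Finset.sum_insert hi, Finset.sum_insert hi]
    exact ENNReal.ofReal_add_le.trans (add_le_add le_rfl ih)

lemma fN_split (n : Bool × Bool → ℕ) (h6 : 6 ≤ ∑ q, n q) :
    fN (∑ q, n q) ≤ ∑ q, 4 * fN (n q) := by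
  have h1 := sq_sum_le_card_mul_sum_sq (s := Finset.univ) (f := fun q => (n q : ℝ))
  have h2 : (6 : ℝ) ≤ ∑ q, (n q : ℝ) := by exact_mod_cast h6
  unfold fN
  push_cast
  have hc : ((Finset.univ : Finset (Bool × Bool)).card : ℝ) = 4 := by simp
  rw [hc] at h1
  have e : ∑ q, 4 * ((n q : ℝ) ^ 2 + 5 * n q - 6)
      = 4 * ∑ q, (n q : ℝ) ^ 2 + 20 * ∑ q, (n q : ℝ) - 96 := by
    simp only [mul_sub, mul_add, Finset.sum_sub_distrib, Finset.sum_add_distrib, ← Finset.mul_sum]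
    rw [Finset.sum_const, ← Nat.cast_smul_eq_nsmul ℝ, hc, smul_eq_mul]
    ring
  rw [e]
  linarith

lemma multi {N : ℕ} {Ψ : Config N → ℂ} (h : Admissible N Ψ) {α : ℝ} (h0 : 0 < α) (h1 : α ≤ 1)
    {U : Set Plane} {δ : ℝ} (hδ : ∀ x : Config N, (∀ l, x l ∈ U) → ∀ j k, j ≠ k →
      |(x j).1 - (x k).1| < δ → |(x j).2 - (x k).2| < δ → Ψ x = 0) (n : ℕ) :
    ∀ (a : Plane) (s : ℝ), 0 < s → s ≤ δ * 2 ^ n → ∀ (J : Finset (Fin N)) (B : Fin N → Set Plane),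
    (∀ l, MeasurableSet (B l)) → (∀ l ∈ J, B l = box a s) →
    (∀ l, l ∉ J → Disjoint (B l) (box a s)) → (∀ l, B l ⊆ U) →
    ENNReal.ofReal (α / (44000000 * s ^ 2) * fN J.card) *
      ∫⁻ x in Set.univ.pi B, ENNReal.ofReal (‖Ψ x‖ ^ 2) ≤
      ∑ j ∈ J, ∫⁻ x in Set.univ.pi B, ENNReal.ofReal (DSq N α j Ψ x) := by
  induction n with
  | zero =>
    intro a s hs hsn J B hB hJ hJ' hU
    by_cases h2 : 2 ≤ J.card
    · obtain ⟨j, hj, k, hk, hjk⟩ := Finset.one_lt_card.1 h2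
      have hz : ∫⁻ x in Set.univ.pi B, ENNReal.ofReal (‖Ψ x‖ ^ 2) = 0 := by
        rw [setLIntegral_congr_fun (g := fun _ => 0) (MeasurableSet.univ_pi hB)]
        · simp
        · intro x hx
          have q1 := hx j (Set.mem_univ _)
          have q2 := hx k (Set.mem_univ _)
          rw [hJ j hj, mem_box] at q1
          rw [hJ k hk, mem_box] at q2
          have : Ψ x = 0 := by
            refine hδ x (fun l => hU l (hx l (Set.mem_univ _))) j k hjk ?_ ?_
            · rw [abs_lt]; constructor <;> linarith [q1.1.1, q1.1.2, q2.1.1, q2.1.2]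
            · rw [abs_lt]; constructor <;> linarith [q1.2.1, q1.2.2, q2.2.1, q2.2.2]
          simp [this]
      rw [hz, mul_zero]; exact zero_le
    · have hf : fN J.card ≤ 0 := by
        have h3 : J.card ≤ 1 := by omega
        have : (J.card : ℝ) ≤ 1 := by exact_mod_cast h3
        have : (0 : ℝ) ≤ J.card := by positivity
        unfold fN; nlinarith
      rw [ENNReal.ofReal_of_nonpos, zero_mul]
      · exact zero_le
      · exact mul_nonpos_of_nonneg_of_nonpos (by positivity) hf
  | succ n ih =>
    intro a s hs hsn J B hB hJ hJ' hU
    by_cases h2 : 2 ≤ J.card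
    swap
    · have hf : fN J.card ≤ 0 := by
        have h3 : J.card ≤ 1 := by omega
        have : (J.card : ℝ) ≤ 1 := by exact_mod_cast h3
        have : (0 : ℝ) ≤ J.card := by positivity
        unfold fN; nlinarith
      rw [ENNReal.ofReal_of_nonpos, zero_mul]
      · exact zero_le
      · exact mul_nonpos_of_nonneg_of_nonpos (by positivity) hf
    by_cases h5 : J.card ≤ 5
    · exact small_case h h0 h1 a hs J B hB hJ hJ' h2 h5
    have hqm := fun (l : Fin N) q => measurableSet_quad a s q
    rw [pi_partition B hB (fun _ => quad a s) hqm, Finset.mul_sum]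
    have e : ∀ j ∈ J, ∫⁻ x in Set.univ.pi B, ENNReal.ofReal (DSq N α j Ψ x) = _ :=
      fun j _ => pi_partition B hB (fun _ => quad a s) hqm _
    rw [Finset.sum_congr rfl e, Finset.sum_comm]
    refine Finset.sum_le_sum fun σ _ => ?_
    have hs2 : 0 < s / 2 := by positivity
    have hI : ∀ q : Bool × Bool, _ := fun q => ih (qcor a s q) (s / 2) hs2
      (by rw [pow_succ] at hsn; linarith) (J.filter fun l => σ l = q)
      (fun l => B l ∩ quad a s ⁻¹' {σ l}) (fun l => (hB l).inter (hqm l _))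
      (by
        intro l hl
        obtain ⟨hl1, hl2⟩ := Finset.mem_filter.1 hl
        rw [hJ l hl1, hl2, box_inter_quad a hs])
      (by
        intro l hl
        by_cases hlJ : l ∈ J
        · have hlq : σ l ≠ q := fun he => hl (Finset.mem_filter.2 ⟨hlJ, he⟩)
          rw [← box_inter_quad a hs q, Set.disjoint_left]
          rintro p ⟨_, hp⟩ ⟨_, hp'⟩
          exact hlq ((hp : quad a s p = σ l).symm.trans hp')
        · exact ((hJ' l hlJ).mono_left Set.inter_subset_left).mono_right (qbox_subset a hs q))
      (fun l => Set.inter_subset_left.trans (hU l))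
    have hcard : J.card = ∑ q, (J.filter fun l => σ l = q).card :=
      Finset.card_eq_sum_card_fiberwise (fun l _ => Finset.mem_univ _)
    rw [← Finset.sum_fiberwise J σ]
    refine le_trans ?_ (Finset.sum_le_sum fun q _ => hI q)
    rw [← Finset.sum_mul]
    refine mul_le_mul' ?_ le_rfl
    refine le_trans ?_ (ofReal_sum_le_sum _ _)
    apply ENNReal.ofReal_le_ofReal
    have h6 : 6 ≤ ∑ q, (J.filter fun l => σ l = q).card := by rw [← hcard]; omega
    have hs := fN_split _ h6
    rw [← hcard] at hs
    calc α / (44000000 * s ^ 2) * fN J.card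
        ≤ α / (44000000 * s ^ 2) * ∑ q, 4 * fN (J.filter fun l => σ l = q).card := by gcongr
      _ = _ := by
        rw [Finset.mul_sum]
        refine Finset.sum_congr rfl fun q _ => ?_
        field_simp
        ring


lemma exists_delta {N : ℕ} {Ψ : Config N → ℂ} (h : Admissible N Ψ) :
    ∃ δ : ℝ, 0 < δ ∧ ∀ x : Config N, (∀ l, x l ∈ Set.Icc (0 : ℝ) 1 ×ˢ Set.Icc (0 : ℝ) 1) →
      ∀ j k, j ≠ k → |(x j).1 - (x k).1| < δ → |(x j).2 - (x k).2| < δ → Ψ x = 0 := by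
  obtain ⟨V, hVo, hVd, hV⟩ := h.vanishes
  have hKc : IsCompact (Set.univ.pi fun _ : Fin N => (Set.Icc (0 : ℝ) 1 ×ˢ Set.Icc (0 : ℝ) 1)) :=
    isCompact_univ_pi fun _ => isCompact_Icc.prod isCompact_Icc
  have hK : IsCompact ((Set.univ.pi fun _ : Fin N => (Set.Icc (0 : ℝ) 1 ×ˢ Set.Icc (0 : ℝ) 1)) ∩ Vᶜ) :=
    hKc.inter_right hVo.isClosed_compl
  set K := (Set.univ.pi fun _ : Fin N => (Set.Icc (0 : ℝ) 1 ×ˢ Set.Icc (0 : ℝ) 1)) ∩ Vᶜ with hKdef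
  have key : ∀ p : Fin N × Fin N, ∀ᶠ δ : ℝ in 𝓝[>] 0,
      p.1 ≠ p.2 → ∀ x ∈ K, δ ≤ dist (x p.1) (x p.2) := by
    intro p
    by_cases hp : p.1 = p.2
    · exact Filter.Eventually.of_forall fun _ hh => absurd hp hh
    rcases K.eq_empty_or_nonempty with hE | hne
    · rw [hE]; exact Filter.Eventually.of_forall fun _ _ x hx => absurd hx (Set.notMem_empty x)
    have hc : Continuous fun x : Config N => dist (x p.1) (x p.2) :=
      (continuous_apply p.1).dist (continuous_apply p.2)
    obtain ⟨z, hz, hmin⟩ := hK.exists_isMinOn hne hc.continuousOn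
    have hpos : 0 < dist (z p.1) (z p.2) := by
      rw [dist_pos]
      intro he
      exact hz.2 (hVd ⟨p.1, p.2, hp, he⟩)
    filter_upwards [Ioo_mem_nhdsGT hpos] with δ hδ _ x hx
    exact hδ.2.le.trans (hmin hx)
  have key2 := (Filter.eventually_all.2 key).and self_mem_nhdsWithin
  obtain ⟨δ, hδ, hδ0⟩ := key2.exists
  refine ⟨δ, hδ0, fun x hx j k hjk h1 h2 => ?_⟩
  by_contra hne
  have hxK : x ∈ K := ⟨fun l _ => hx l, fun hxV => hne (hV x hxV)⟩
  have := hδ (j, k) hjk x hxK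
  rw [Prod.dist_eq, Real.dist_eq, Real.dist_eq] at this
  exact absurd this (not_le.2 (max_lt h1 h2))

lemma cube_ae (N : ℕ) :
    (cube N Q0 : Set (Config N)) =ᵐ[volume] Set.univ.pi fun _ : Fin N => box (0, 0) 1 := by
  have h1 : (Q0 : Set Plane) =ᵐ[volume] box (0, 0) 1 := by
    unfold Q0 box
    simp only [zero_add]
    exact Measure.set_prod_ae_eq Ioo_ae_eq_Ico Ioo_ae_eq_Ico
  exact Measure.ae_eq_set_pi fun _ _ => h1

lemma Q0_subset : Q0 ⊆ Set.Icc (0 : ℝ) 1 ×ˢ Set.Icc (0 : ℝ) 1 :=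
  Set.prod_mono Ioo_subset_Icc_self Ioo_subset_Icc_self

lemma cube_integrable {N : ℕ} {f : Config N → ℝ} (hf : Continuous f) :
    IntegrableOn f (cube N Q0) := by
  have hKc : IsCompact (Set.univ.pi fun _ : Fin N => (Set.Icc (0 : ℝ) 1 ×ˢ Set.Icc (0 : ℝ) 1)) :=
    isCompact_univ_pi fun _ => isCompact_Icc.prod isCompact_Icc
  exact (hf.continuousOn.integrableOn_compact hKc).mono_set
    (Set.pi_mono fun _ _ => Q0_subset)

lemma kin_lower {N : ℕ} {Ψ : Config N → ℂ} (h : Admissible N Ψ) {α : ℝ} (h0 : 0 < α) (h1 : α ≤ 1)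
    (hn : normSq N Q0 Ψ = 1) : α / 44000000 * fN N ≤ kinE N α Q0 Ψ := by
  obtain ⟨δ, hδ0, hδ⟩ := exists_delta h
  obtain ⟨n, hn1⟩ := pow_unbounded_of_one_lt (1 / δ) (one_lt_two : (1 : ℝ) < 2)
  have hsn : (1 : ℝ) ≤ δ * 2 ^ n := by
    rw [div_lt_iff₀ hδ0] at hn1; linarith
  have hm := multi h h0 h1 hδ n (0, 0) 1 one_pos hsn Finset.univ (fun _ => box (0, 0) 1)
    (fun _ => measurableSet_box _ _) (fun _ _ => rfl)
    (fun l hl => absurd (Finset.mem_univ l) hl)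
    (fun _ p hp => by
      rw [mem_box] at hp
      simp only [zero_add] at hp
      exact ⟨⟨hp.1.1, hp.1.2.le⟩, ⟨hp.2.1, hp.2.2.le⟩⟩)
  have hcΨ : Continuous fun x => ‖Ψ x‖ ^ 2 := h.continuous.norm.pow 2
  have e1 : ∫⁻ x in Set.univ.pi (fun _ : Fin N => box (0, 0) 1), ENNReal.ofReal (‖Ψ x‖ ^ 2) = 1 := by
    rw [← setLIntegral_congr (cube_ae N), ← ofReal_integral_eq_lintegral_ofReal
      (cube_integrable hcΨ) (Filter.Eventually.of_forall fun x => by positivity)]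
    have : ∫ x in cube N Q0, ‖Ψ x‖ ^ 2 = 1 := hn
    rw [this, ENNReal.ofReal_one]
  have e2 : ∀ j, ∫⁻ x in Set.univ.pi (fun _ : Fin N => box (0, 0) 1),
      ENNReal.ofReal (DSq N α j Ψ x) = ENNReal.ofReal (∫ x in cube N Q0, DSq N α j Ψ x) := by
    intro j
    rw [← setLIntegral_congr (cube_ae N), ← ofReal_integral_eq_lintegral_ofReal
      (cube_integrable (DSq_continuous h α j))
      (Filter.Eventually.of_forall fun x => DSq_nonneg Ψ α j x)]
  have hnn : ∀ j, 0 ≤ ∫ x in cube N Q0, DSq N α j Ψ x :=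
    fun j => integral_nonneg fun x => DSq_nonneg Ψ α j x
  rw [e1, mul_one, Finset.sum_congr rfl (fun j _ => e2 j),
    ← ENNReal.ofReal_sum_of_nonneg (fun j _ => hnn j),
    ENNReal.ofReal_le_ofReal_iff (Finset.sum_nonneg fun j _ => hnn j)] at hm
  simpa [kinE] using hm

/-- A smooth cutoff, positive when all pairs are well separated. -/
def cutPair (M : ℝ) (v : Plane) : ℝ := Real.smoothTransition (M * (v.1 ^ 2 + v.2 ^ 2) - 1)

/-- A trial state. -/
def trial (N : ℕ) (M : ℝ) (x : Config N) : ℝ :=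
  ∏ j : Fin N, ∏ k : Fin N, if j = k then 1 else cutPair M (x j - x k)

lemma trial_smooth (N : ℕ) (M : ℝ) : ContDiff ℝ (⊤ : ℕ∞) (trial N M) := by
  have hc : ContDiff ℝ (⊤ : ℕ∞) (cutPair M) := by
    have : ContDiff ℝ (⊤ : ℕ∞) fun v : Plane => M * (v.1 ^ 2 + v.2 ^ 2) - 1 := by fun_prop
    exact Real.smoothTransition.contDiff.comp this
  unfold trial
  refine contDiff_prod fun j _ => contDiff_prod fun k _ => ?_
  split_ifs
  · exact contDiff_const
  · have : ContDiff ℝ (⊤ : ℕ∞) fun x : Config N => x j - x k := by fun_prop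
    exact hc.comp this

lemma trial_admissible (N : ℕ) (M c : ℝ) :
    Admissible N (fun x => ((c * trial N M x : ℝ) : ℂ)) := by
  refine ⟨?_, ?_, ?_⟩
  · exact Complex.ofRealCLM.contDiff.comp (contDiff_const.mul (trial_smooth N M))
  · intro σ x
    congr 2
    unfold trial
    rw [← Equiv.prod_comp σ (fun j => ∏ k : Fin N, if j = k then 1 else cutPair M (x j - x k))]
    refine Finset.prod_congr rfl fun j _ => ?_
    rw [← Equiv.prod_comp σ (fun k => if σ j = k then 1 else cutPair M (x (σ j) - x k))]
    refine Finset.prod_congr rfl fun k _ => ?_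
    simp
  · refine ⟨⋃ j : Fin N, ⋃ k : Fin N, {x | j ≠ k ∧
      M * ((x j - x k).1 ^ 2 + (x j - x k).2 ^ 2) < 1}, ?_, ?_, ?_⟩
    · refine isOpen_iUnion fun j => isOpen_iUnion fun k => ?_
      have hcc : Continuous fun x : Config N =>
          M * ((x j - x k).1 ^ 2 + (x j - x k).2 ^ 2) := by fun_prop
      have ho : IsOpen {x : Config N | M * ((x j - x k).1 ^ 2 + (x j - x k).2 ^ 2) < 1} :=
        isOpen_lt hcc continuous_const
      by_cases hjk : j = k
      · simp [hjk]
      · simpa [hjk] using ho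
    · rintro x ⟨j, k, hjk, hx⟩
      simp only [Set.mem_iUnion]
      refine ⟨j, k, hjk, ?_⟩
      simp [hx]
    · intro x hx
      simp only [Set.mem_iUnion] at hx
      obtain ⟨j, k, hjk, hx⟩ := hx
      have : trial N M x = 0 := by
        unfold trial
        refine Finset.prod_eq_zero (Finset.mem_univ j) (Finset.prod_eq_zero (Finset.mem_univ k) ?_)
        rw [if_neg hjk]
        exact Real.smoothTransition.zero_of_nonpos (by linarith)
      simp [this]

lemma isOpen_Q0 : IsOpen Q0 := isOpen_Ioo.prod isOpen_Ioo

lemma exists_state (N : ℕ) : ∃ Ψ : Config N → ℂ, Admissible N Ψ ∧ normSq N Q0 Ψ = 1 := by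
  set M : ℝ := 2 * ((N : ℝ) + 1) ^ 2 with hM
  have hN : (0 : ℝ) < (N : ℝ) + 1 := by positivity
  set p : Config N := fun i => (((i : ℕ) + 1 : ℝ) / (N + 1), 1 / 2) with hp
  have hpQ : p ∈ cube N Q0 := by
    intro i _
    refine ⟨⟨by simp only [hp]; positivity, ?_⟩, ⟨by simp [hp], by simp only [hp]; norm_num⟩⟩
    simp only [hp]
    rw [div_lt_one hN]
    have : ((i : ℕ) : ℝ) < N := by exact_mod_cast i.2
    linarith
  have hpos : 0 < trial N M p := by
    unfold trial
    refine Finset.prod_pos fun j _ => Finset.prod_pos fun k _ => ?_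
    split_ifs with hjk
    · exact one_pos
    · refine Real.smoothTransition.pos_of_pos ?_
      have h1 : (p j - p k).1 = (((j : ℕ) : ℝ) - ((k : ℕ) : ℝ)) / (N + 1) := by
        simp only [hp, Prod.fst_sub]; field_simp; ring
      have h2 : (p j - p k).2 = 0 := by simp [hp]
      rw [h1, h2]
      have h3 : (1 : ℝ) ≤ (((j : ℕ) : ℝ) - ((k : ℕ) : ℝ)) ^ 2 := by
        have h4 : ((j : ℕ) : ℤ) - ((k : ℕ) : ℤ) ≠ 0 := by
          intro h5
          apply hjk
          ext; omega
        have h5 : (1 : ℤ) ≤ (((j : ℕ) : ℤ) - ((k : ℕ) : ℤ)) ^ 2 := by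
          have := sq_pos_of_ne_zero h4
          omega
        exact_mod_cast h5
      rw [hM]
      have : 2 * ((N : ℝ) + 1) ^ 2 * (((((j : ℕ) : ℝ) - ((k : ℕ) : ℝ)) / (N + 1)) ^ 2 + 0 ^ 2)
          = 2 * (((j : ℕ) : ℝ) - ((k : ℕ) : ℝ)) ^ 2 := by field_simp; ring
      rw [this]; linarith
  have hcont : Continuous (trial N M) := (trial_smooth N M).continuous
  have hsq : Continuous fun x => trial N M x ^ 2 := hcont.pow 2
  have hopen : IsOpen (cube N Q0) := isOpen_set_pi Set.finite_univ fun _ _ => isOpen_Q0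
  have hI : 0 < ∫ x in cube N Q0, trial N M x ^ 2 := by
    rw [setIntegral_pos_iff_support_of_nonneg_ae
      (Filter.Eventually.of_forall fun x => sq_nonneg _) (cube_integrable hsq)]
    have ho : IsOpen (Function.support (fun x => trial N M x ^ 2) ∩ cube N Q0) :=
      hsq.isOpen_support.inter hopen
    exact ho.measure_pos volume ⟨p, (pow_pos hpos 2).ne', hpQ⟩
  set I := ∫ x in cube N Q0, trial N M x ^ 2 with hIdef
  refine ⟨_, trial_admissible N M (1 / √I), ?_⟩
  unfold normSq
  have : ∀ x, ‖((1 / √I * trial N M x : ℝ) : ℂ)‖ ^ 2 = 1 / I * trial N M x ^ 2 := by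
    intro x
    rw [Complex.norm_real, Real.norm_eq_abs, sq_abs, mul_pow, div_pow, Real.sq_sqrt hI.le, one_pow]
  simp_rw [this]
  rw [integral_const_mul, ← hIdef, one_div, inv_mul_cancel₀ hI.ne']

lemma EN_nonneg (N : ℕ) (α : ℝ) : 0 ≤ EN N α := by
  unfold EN neumannE
  split_ifs
  · exact le_rfl
  · apply Real.sInf_nonneg
    rintro E ⟨Ψ, _, _, rfl⟩
    exact Finset.sum_nonneg fun j _ => integral_nonneg fun x => DSq_nonneg Ψ α j x


/-- There exist constants `C₁ > 0` and `C > 0` such that for every `α ∈ [0,1]`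
and every integer `N ≥ 1`, `E^N_N(α) ≥ C₁ α N² (1 − C/N)`. -/
theorem neumann_global_lower_bound :
    ∃ C₁ C : ℝ, 0 < C₁ ∧ 0 < C ∧ ∀ α ∈ Set.Icc (0 : ℝ) 1, ∀ N : ℕ, 1 ≤ N →
      C₁ * α * (N : ℝ) ^ 2 * (1 - C / (N : ℝ)) ≤ EN N α := by
  refine ⟨1 / 44000000, 1, by norm_num, one_pos, ?_⟩
  rintro α ⟨hα0, hα1⟩ N hN
  have hN1 : (1 : ℝ) ≤ N := by exact_mod_cast hN
  have hN0 : (N : ℝ) ≠ 0 := by positivity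
  rcases hα0.eq_or_lt with rfl | hα
  · simpa using EN_nonneg N 0
  have e : 1 / 44000000 * α * (N : ℝ) ^ 2 * (1 - 1 / (N : ℝ))
      = α / 44000000 * ((N : ℝ) ^ 2 - N) := by field_simp
  have hle : α / 44000000 * ((N : ℝ) ^ 2 - N) ≤ α / 44000000 * fN N := by
    refine mul_le_mul_of_nonneg_left ?_ (by positivity)
    unfold fN; linarith
  rw [e]
  refine hle.trans ?_
  unfold EN neumannE
  rw [if_neg (by omega)]
  obtain ⟨Ψ₀, hΨ₀, hn₀⟩ := exists_state N
  refine le_csInf ⟨_, Ψ₀, hΨ₀, hn₀, rfl⟩ ?_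
  rintro E ⟨Ψ, hΨ, hn, rfl⟩
  exact kin_lower hΨ hα hα1 hn
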